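/- (Huh–Wang; Dowling–Wilson top-heavy conjecture in the representable case) Let M be a loopless matroid of rank r on a finite ground set E that is representable over some field, and for 0 ≤ k ≤ r let W_k(M) denote the number of flats of M of rank k. Then for every k with k ≤ r/2, W_k(M) ≤ W_{r−k}(M). -/

import Mathlib

/-- A matroid on a finite ground set `E`, given by the independence axioms (I1)-(I3). -/
structure FinMatroid (E : Type*) [Fintype E] [DecidableEq E] where
  Indep : Finset E → Prop
  indep_empty : Indep ∅
  indep_subset : ∀ ⦃I J : Finset E⦄, Indep J → I ⊆ J → Indep I
  indep_exchange : ∀ ⦃I J : Finset E⦄, Indep I → Indep J → I.card < J.card →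
    ∃ e ∈ J, e ∉ I ∧ Indep (insert e I)

namespace FinMatroid

variable {E : Type*} [Fintype E] [DecidableEq E]

open Classical in
/-- The rank of a subset `A`: the maximal cardinality of an independent subset of `A`. -/
noncomputable def rank (M : FinMatroid E) (A : Finset E) : ℕ :=
  (A.powerset.filter fun I => M.Indep I).sup Finset.card

/-- The rank of the matroid. -/
noncomputable def rk (M : FinMatroid E) : ℕ := M.rank Finset.univ

/-- The closure of a subset `A`: all elements `x` with `r(A ∪ {x}) = r(A)`. -/
noncomputable def closure (M : FinMatroid E) (A : Finset E) : Finset E :=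
  Finset.univ.filter fun x => M.rank (insert x A) = M.rank A

/-- A flat is a closed subset. -/
def IsFlat (M : FinMatroid E) (F : Finset E) : Prop := M.closure F = F

/-- A matroid is loopless if the closure of the empty set is empty. -/
def Loopless (M : FinMatroid E) : Prop := M.closure ∅ = ∅

/-- A basis is a maximal independent set. -/
def IsBase (M : FinMatroid E) (B : Finset E) : Prop :=
  M.Indep B ∧ ∀ ⦃J⦄, M.Indep J → B ⊆ J → J = B

open Classical in
/-- The finset of all flats of `M`. -/
noncomputable def flats (M : FinMatroid E) : Finset (Finset E) :=
  Finset.univ.filter fun F => M.IsFlat F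

open Classical in
/-- `mu` is the Möbius function of the lattice of flats of `M`: it satisfies `mu F F = 1`,
`mu F F' = 0` when `¬ F ⊆ F'`, and for `F ⊂ F'` the sum of `mu F G` over the flats
`F ⊆ G ⊆ F'` vanishes. These properties determine `mu` uniquely on pairs of flats. -/
def IsMobius (M : FinMatroid E) (mu : Finset E → Finset E → ℤ) : Prop :=
  (∀ F ∈ M.flats, mu F F = 1) ∧
  (∀ F ∈ M.flats, ∀ F' ∈ M.flats, ¬F ⊆ F' → mu F F' = 0) ∧
  (∀ F ∈ M.flats, ∀ F' ∈ M.flats, F ⊂ F' →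
    ∑ G ∈ M.flats.filter (fun G => F ⊆ G ∧ G ⊆ F'), mu F G = 0)

open Classical in
/-- The characteristic polynomial of a matroid `M` (relative to the Möbius function `mu` of
its lattice of flats): `χ_M(t) = Σ_{F ∈ L(M)} μ(∅,F) t^{r(E) - r(F)}` if `M` is loopless,
and `0` if `M` has a loop. -/
noncomputable def charPoly (M : FinMatroid E) (mu : Finset E → Finset E → ℤ) : Polynomial ℤ :=
  if M.Loopless then
    ∑ F ∈ M.flats, Polynomial.C (mu ∅ F) * Polynomial.X ^ (M.rk - M.rank F)
  else 0

end FinMatroid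

namespace FinMatroid

variable {E : Type*} [Fintype E] [DecidableEq E]

/-- A matroid is representable over some field if there are a field `K`, a `K`-vector space
`V`, and a map `φ : E → V` such that a set `I` is independent in `M` exactly when `φ` is
injective on `I` and `φ(I)` is linearly independent over `K`. -/
def Representable (M : FinMatroid E) : Prop :=
  ∃ (K : Type) (_ : Field K) (V : Type) (_ : AddCommGroup V),
    ∃ (_ : Module K V) (φ : E → V),
      ∀ I : Finset E, M.Indep I ↔
        (Set.InjOn φ (I : Set E) ∧
          LinearIndependent K (fun v : (φ '' (I : Set E)) => (v : V)))

open Classical in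
/-- The Whitney numbers of the second kind: `W k` is the number of flats of `M` of rank `k`. -/
noncomputable def whitneySecond (M : FinMatroid E) (k : ℕ) : ℕ :=
  ((Finset.univ : Finset (Finset E)).filter fun F => M.IsFlat F ∧ M.rank F = k).card

end FinMatroid

namespace TopHeavy

section abs
variable {E : Type*} [NormedAddCommGroup E] [NormedSpace ℝ E] [FiniteDimensional ℝ E]

/-- Representability of functionals through a perfect pairing of two subspaces. -/
theorem riesz (β : E →ₗ[ℝ] E →ₗ[ℝ] ℝ) (P Q : Submodule ℝ E)
    (hP : ∀ p ∈ P, (∀ q ∈ Q, β p q = 0) → p = 0)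
    (hQ : ∀ q ∈ Q, (∀ p ∈ P, β p q = 0) → q = 0) (φ : E →ₗ[ℝ] ℝ) :
    ∃ p ∈ P, ∀ q ∈ Q, β p q = φ q := by
  let Φ : P →ₗ[ℝ] Module.Dual ℝ Q := (β.domRestrict P).compr₂ (LinearMap.id) |>.compl₂ Q.subtype
  let Ψ : Q →ₗ[ℝ] Module.Dual ℝ P := ((β.flip).domRestrict Q).compl₂ P.subtype
  have hΦ : Function.Injective Φ := by
    rw [← LinearMap.ker_eq_bot, LinearMap.ker_eq_bot']
    intro p hp
    apply Subtype.ext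
    apply hP _ p.2
    intro q hq
    have := LinearMap.congr_fun hp ⟨q, hq⟩
    simpa [Φ] using this
  have hΨ : Function.Injective Ψ := by
    rw [← LinearMap.ker_eq_bot, LinearMap.ker_eq_bot']
    intro q hq
    apply Subtype.ext
    apply hQ _ q.2
    intro p hp
    have := LinearMap.congr_fun hq ⟨p, hp⟩
    simpa [Ψ] using this
  have h1 := LinearMap.finrank_le_finrank_of_injective hΦ
  have h2 := LinearMap.finrank_le_finrank_of_injective hΨ
  rw [Subspace.dual_finrank_eq] at h1 h2
  have hs : Function.Surjective Φ := by
    apply (LinearMap.injective_iff_surjective_of_finrank_eq_finrank _).1 hΦ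
    rw [Subspace.dual_finrank_eq]
    exact le_antisymm h1 h2
  obtain ⟨p, hp⟩ := hs (φ.domRestrict Q)
  refine ⟨p, p.2, fun q hq => ?_⟩
  have := LinearMap.congr_fun hp ⟨q, hq⟩
  simpa [Φ] using this

theorem mem_of_perp (β : E →ₗ[ℝ] E →ₗ[ℝ] ℝ) (P Q I : Submodule ℝ E) 
    (hP : ∀ p ∈ P, (∀ q ∈ Q, β p q = 0) → p = 0)
    (hQ : ∀ q ∈ Q, (∀ p ∈ P, β p q = 0) → q = 0) (hI : I ≤ Q) (x : E) (hx : x ∈ Q)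
    (h : ∀ p ∈ P, (∀ q ∈ I, β p q = 0) → β p x = 0) : x ∈ I := by
  by_contra hxI
  obtain ⟨φ, hφ, hφI⟩ := Submodule.exists_le_ker_of_notMem hxI
  obtain ⟨p, hp, hpq⟩ := riesz β P Q hP hQ φ
  have := h p hp (fun q hq => by rw [hpq q (hI hq)]; exact hφI hq)
  rw [hpq x hx] at this
  exact hφ this

/-- Continuous right inverses of a continuous family of linear maps that is surjective at `s₀`. -/
theorem right_inv_family {P Q : Type*} [NormedAddCommGroup P] [NormedSpace ℝ P]
    [FiniteDimensional ℝ P] [NormedAddCommGroup Q] [NormedSpace ℝ Q] [FiniteDimensional ℝ Q]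
    (f : ℝ → P →ₗ[ℝ] Q) (s₀ : ℝ) (hf : ∀ p, ContinuousAt (fun s => f s p) s₀)
    (hs : Function.Surjective (f s₀)) :
    ∃ e : ℝ → Q →ₗ[ℝ] P, (∀ u : ℝ → Q, ContinuousAt u s₀ → ContinuousAt (fun s => e s (u s)) s₀) ∧
      ∀ᶠ s in nhds s₀, ∀ q, f s (e s q) = q := by
  classical
  obtain ⟨σ, hσ⟩ := (f s₀).exists_rightInverse_of_surjective (LinearMap.range_eq_top.2 hs)
  let b := Module.finBasis ℝ Q
  let M : ℝ → Matrix _ _ ℝ := fun s => LinearMap.toMatrix b b (f s ∘ₗ σ)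
  have hM : ContinuousAt M s₀ := by
    apply continuousAt_pi.2
    intro i
    apply continuousAt_pi.2
    intro j
    have : (fun s => M s i j) = fun s => b.coord i (f s (σ (b j))) := by
      funext s
      simp [M, LinearMap.toMatrix_apply]
    rw [this]
    exact (LinearMap.continuous_of_finiteDimensional (b.coord i)).continuousAt.comp (hf _)
  have hM0 : M s₀ = 1 := by
    simp only [M]; rw [hσ]; exact LinearMap.toMatrix_id b
  have hdet : ContinuousAt (fun s => (M s).det) s₀ :=
    (Continuous.matrix_det continuous_id).continuousAt.comp hM
  have hadj : ContinuousAt (fun s => (M s).adjugate) s₀ :=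
    (Continuous.matrix_adjugate continuous_id).continuousAt.comp hM
  have hd0 : (M s₀).det = 1 := by rw [hM0]; simp
  let R : ℝ → Matrix _ _ ℝ := fun s => ((M s).det)⁻¹ • (M s).adjugate
  have hR : ContinuousAt R s₀ := (hdet.inv₀ (by rw [hd0]; norm_num)).smul hadj
  refine ⟨fun s => σ ∘ₗ Matrix.toLin b b (R s), ?_, ?_⟩
  · intro u hu
    have h1 : (fun s => (σ ∘ₗ Matrix.toLin b b (R s)) (u s)) =
        fun s => ∑ i, (R s).mulVec (b.repr (u s)) i • σ (b i) := by
      funext s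
      simp [Matrix.toLin_apply]
    rw [h1]
    have hrep : ContinuousAt (fun s => (fun i => b.repr (u s) i)) s₀ := by
      apply continuousAt_pi.2
      intro i
      exact (LinearMap.continuous_of_finiteDimensional (b.coord i)).continuousAt.comp hu
    apply tendsto_finsetSum
    intro i _
    refine Filter.Tendsto.smul_const ?_ _
    simp only [Matrix.mulVec, dotProduct]
    apply tendsto_finsetSum
    intro j _
    exact Filter.Tendsto.mul ((continuousAt_pi.1 (continuousAt_pi.1 hR i)) j) (continuousAt_pi.1 hrep j)
  · have : ∀ᶠ s in nhds s₀, (M s).det ≠ 0 := hdet.eventually_ne (by rw [hd0]; norm_num)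
    filter_upwards [this] with s hs q
    have h2 : (f s ∘ₗ σ) ∘ₗ Matrix.toLin b b (R s) = LinearMap.id := by
      apply (LinearMap.toMatrix b b).injective
      rw [LinearMap.toMatrix_comp b b b, LinearMap.toMatrix_toLin, LinearMap.toMatrix_id]
      change M s * R s = 1
      simp only [R]
      rw [Matrix.mul_smul, Matrix.mul_adjugate, smul_smul, inv_mul_cancel₀ hs, one_smul]
    exact LinearMap.congr_fun h2 q

end abs
end TopHeavy

namespace TopHeavy

set_option linter.unusedSectionVars false

section ops
variable {E : Type*} [NormedAddCommGroup E] [NormedSpace ℝ E]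

/-- Hodge-Riemann relations for the operator `N` on the graded family `B`. -/
def HR (β : E →ₗ[ℝ] E →ₗ[ℝ] ℝ) (r : ℕ) (B : ℕ → Submodule ℝ E) (N : Module.End ℝ E) : Prop :=
  ∀ k, 2 * k ≤ r → ∀ x ∈ B k, (N ^ (r - 2 * k + 1)) x = 0 → x ≠ 0 →
    0 < (-1) ^ k * β x ((N ^ (r - 2 * k)) x)

/-- Self-adjoint operators of degree one. -/
structure Op (β : E →ₗ[ℝ] E →ₗ[ℝ] ℝ) (B : ℕ → Submodule ℝ E) (N : Module.End ℝ E) : Prop where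
  adj : ∀ a b, β (N a) b = β a (N b)
  stab : ∀ k x, x ∈ B k → N x ∈ B (k + 1)

structure Sys (β : E →ₗ[ℝ] E →ₗ[ℝ] ℝ) (r : ℕ) (B : ℕ → Submodule ℝ E) : Prop where
  symm : ∀ a b, β a b = β b a
  top : ∀ k, r < k → ∀ x ∈ B k, x = 0
  nondeg : ∀ k, k ≤ r → ∀ x ∈ B k, (∀ x' ∈ B (r - k), β x x' = 0) → x = 0

structure Pre (β : E →ₗ[ℝ] E →ₗ[ℝ] ℝ) (r : ℕ) (B : ℕ → Submodule ℝ E)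
    (y N : Module.End ℝ E) : Prop where
  sys : Sys β r B
  opN : Op β B N
  opy : Op β B y
  comm : Commute N y
  sq : y * y = 0
  hr : ∀ t : ℝ, 0 < t → HR β r B (N + t • y)

variable {β : E →ₗ[ℝ] E →ₗ[ℝ] ℝ} {r : ℕ} {B : ℕ → Submodule ℝ E} {y N z : Module.End ℝ E}

theorem Op.pow_adj (h : Op β B N) (m : ℕ) (a b : E) : β ((N ^ m) a) b = β a ((N ^ m) b) := by
  induction m generalizing a b with
  | zero => simp
  | succ m ih =>
    rw [pow_succ, Module.End.mul_apply, Module.End.mul_apply, ih, h.adj, ← Module.End.mul_apply,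
      ← Module.End.mul_apply, (Commute.refl N).pow_right m]

theorem Op.pow_stab (h : Op β B N) (m k j : ℕ) (hj : k + m = j) (x : E) (hx : x ∈ B k) :
    (N ^ m) x ∈ B j := by
  subst hj
  induction m with
  | zero => simpa
  | succ m ih =>
    rw [pow_succ', Module.End.mul_apply]
    exact h.stab _ _ ih

theorem Op.add (h : Op β B N) (h' : Op β B z) : Op β B (N + z) :=
  ⟨fun a b => by simp [h.adj, h'.adj], fun k x hx => (B _).add_mem (h.stab k x hx) (h'.stab k x hx)⟩

theorem Op.smul (h : Op β B N) (s : ℝ) : Op β B (s • N) :=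
  ⟨fun a b => by simp [h.adj], fun k x hx => (B _).smul_mem _ (h.stab k x hx)⟩

theorem pow_add_sq (hc : Commute N z) (hz : z * z = 0) (s : ℝ) (d : ℕ) :
    (N + s • z) ^ d = N ^ d + (d * s) • (N ^ (d - 1) * z) := by
  induction d with
  | zero => simp
  | succ d ih =>
    rw [pow_succ, ih]
    have h1 : N ^ (d - 1) * z * N = N ^ (d - 1) * N * z := by
      rw [mul_assoc, hc.eq.symm, mul_assoc]
    have h2 : N ^ (d - 1) * z * z = 0 := by rw [mul_assoc, hz, mul_zero]
    rcases d with _ | d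
    · simp
    · simp only [Nat.add_sub_cancel] at h1 h2 ⊢
      rw [mul_add, add_mul, add_mul, smul_mul_assoc, smul_mul_smul_comm, h1, h2, ← pow_succ,
        ← pow_succ, mul_smul_comm]
      push_cast
      module

theorem pow_zero_of_le {m m' : ℕ} (h : m ≤ m') {x : E} (hx : (N ^ m) x = 0) : (N ^ m') x = 0 := by
  obtain ⟨j, rfl⟩ := Nat.exists_eq_add_of_le h
  rw [add_comm, pow_add, Module.End.mul_apply, hx, map_zero]

theorem pow_app_comm (hc : Commute N z) (m : ℕ) (x : E) : (N ^ m) (z x) = z ((N ^ m) x) := by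
  rw [← Module.End.mul_apply, ← Module.End.mul_apply, (hc.pow_left m).eq]

theorem pow_app_add (m n : ℕ) (x : E) : (N ^ m) ((N ^ n) x) = (N ^ (m + n)) x := by
  rw [pow_add, Module.End.mul_apply]

theorem pow_app_succ (m : ℕ) (x : E) : (N ^ m) (N x) = (N ^ (m + 1)) x := by
  rw [pow_succ, Module.End.mul_apply]

theorem app_pow_succ (m : ℕ) (x : E) : N ((N ^ m) x) = (N ^ (m + 1)) x := by
  rw [pow_succ', Module.End.mul_apply]

/-- the degree `k` part of the kernel of `N^(r - 2 * k)` -/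
def T0 (r : ℕ) (B : ℕ → Submodule ℝ E) (N : Module.End ℝ E) (k : ℕ) : Submodule ℝ E :=
  B k ⊓ LinearMap.ker (N ^ (r - 2 * k))

theorem mem_T0 {k : ℕ} {x : E} : x ∈ T0 r B N k ↔ x ∈ B k ∧ (N ^ (r - 2 * k)) x = 0 := by
  simp [T0]

theorem lemB (h : Pre β r B y N) {k : ℕ} (hk : 2 * k < r) {a : E} (ha : a ∈ T0 r B N k)
    (h0 : a ≠ 0) : 0 < (-1) ^ k * β a ((N ^ (r - 2 * k - 1)) (y a)) := by
  obtain ⟨haB, haN⟩ := mem_T0.1 ha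
  have h1 := h.hr 1 one_pos k hk.le a haB
  rw [pow_add_sq h.comm h.sq, pow_add_sq h.comm h.sq] at h1
  have h2 := h1 (by
    have e : (N ^ (r - 2 * k)) (y a) = 0 := by rw [pow_app_comm h.comm, haN, map_zero]
    simp [pow_zero_of_le (Nat.le_succ _) haN, e]) h0
  have hd : (0 : ℝ) < ((r - 2 * k : ℕ) : ℝ) := by
    have : 0 < r - 2 * k := by omega
    exact_mod_cast this
  simp only [LinearMap.add_apply, haN, zero_add, LinearMap.smul_apply, map_smul, smul_eq_mul,
    mul_one, Module.End.mul_apply] at h2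
  have h3 : 0 < ((r - 2 * k : ℕ) : ℝ) * ((-1) ^ k * β a ((N ^ (r - 2 * k - 1)) (y a))) := by
    linarith
  exact (pos_iff_pos_of_mul_pos h3).1 hd

theorem lemC (h : Pre β r B y N) {j m : ℕ} (hj : 2 * (j + 1) ≤ r) (hm : m ≤ r - 2 * j - 1) {x : E}
    (hx : x ∈ B j) (h0 : (N ^ m) x = 0) : x = 0 := by
  have h1 : (N ^ (r - 2 * j - 1)) x = 0 := pow_zero_of_le hm h0
  by_contra hne
  have := lemB h (k := j) (by omega) (mem_T0.2 ⟨hx, pow_zero_of_le (by omega) h1⟩) hne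
  rw [← h.opN.pow_adj, h1] at this
  simp at this

end ops

section fin
variable {E : Type*} [NormedAddCommGroup E] [NormedSpace ℝ E] [FiniteDimensional ℝ E]
variable {β : E →ₗ[ℝ] E →ₗ[ℝ] ℝ} {r : ℕ} {B : ℕ → Submodule ℝ E} {y N z : Module.End ℝ E}

theorem Sys.mem_of_perp (h : Sys β r B) {k l : ℕ} (hk : k + l = r) (I : Submodule ℝ E)
    (hI : I ≤ B l) (x : E) (hx : x ∈ B l)
    (hp : ∀ p ∈ B k, (∀ q ∈ I, β p q = 0) → β p x = 0) : x ∈ I := by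
  have h1 : r - k = l := by omega
  have h2 : r - l = k := by omega
  apply TopHeavy.mem_of_perp β (B k) (B l) I _ _ hI x hx hp
  · intro p hp hq
    exact h.nondeg k (by omega) p hp (by rwa [h1])
  · intro q hq hp
    refine h.nondeg l (by omega) q hq ?_
    rw [h2]
    intro p hp'
    rw [h.symm, hp p hp']

theorem lemSurj' (hS : Sys β r B) (hN : Op β B N) {k : ℕ} (hk : 2 * k ≤ r)
    (hinj : ∀ j, j + 1 = k → ∀ p ∈ B j, (N ^ (r - 2 * k + 1)) p = 0 → p = 0) {x : E} (hx : x ∈ B (r - k + 1)) :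
    ∃ x' ∈ B k, (N ^ (r - 2 * k + 1)) x' = x := by
  rcases k with _ | k
  · exact ⟨0, (B 0).zero_mem, by rw [hS.top _ (by omega) x hx, map_zero]⟩
  · have := hS.mem_of_perp (k := k) (l := r - (k + 1) + 1) (by omega)
      ((B (k + 1)).map (N ^ (r - 2 * (k + 1) + 1))) (by
        rintro _ ⟨x', hx', rfl⟩
        exact hN.pow_stab _ _ _ (by omega) x' hx') x hx (by
        intro p hp hq
        have : p = 0 := by
          apply hinj k rfl p hp
          apply hS.nondeg (r - (k + 1)) (by omega)
          · exact hN.pow_stab _ _ _ (by omega) p hp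
          · intro x' hx'
            rw [hN.pow_adj]
            apply hq
            refine ⟨x', ?_, rfl⟩
            rwa [show r - (r - (k + 1)) = k + 1 by omega] at hx'
        rw [this]; simp)
    obtain ⟨x', hx', h'⟩ := this
    exact ⟨x', hx', h'⟩

theorem lemSurj (h : Pre β r B y N) {k : ℕ} (hk : 2 * k ≤ r) {x : E} (hx : x ∈ B (r - k + 1)) :
    ∃ x' ∈ B k, (N ^ (r - 2 * k + 1)) x' = x := by
  refine lemSurj' h.sys h.opN hk ?_ hx
  intro j hj p hp h0
  exact lemC h (m := r - 2 * k + 1) (by omega) (by omega) hp h0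

theorem lemD' (hS : Sys β r B) (hN : Op β B N) {k : ℕ} (hk : 2 * k ≤ r) {x : E} (hx : x ∈ B (r - k))
    (hp : ∀ x' ∈ B k, (N ^ (r - 2 * k + 1)) x' = 0 → β x' x = 0) :
    ∃ h, (N ^ (r - 2 * k + 1)) h = x ∧ (k = 0 → h = 0) ∧ (∀ j, j + 1 = k → h ∈ B j) := by
  rcases k with _ | k
  · refine ⟨0, ?_, fun _ => rfl, fun j hj => by omega⟩
    rw [map_zero]
    symm
    apply hS.nondeg (r - 0) (by omega) x hx
    intro x' hx'
    rw [show r - (r - 0) = 0 by omega] at hx'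
    rw [hS.symm]
    apply hp x' hx'
    exact hS.top (r + 1) (by omega) _ (hN.pow_stab _ _ _ (by omega) x' hx')
  · have := hS.mem_of_perp (k := k + 1) (l := r - (k + 1)) (by omega)
      ((B k).map (N ^ (r - 2 * (k + 1) + 1))) (by
        rintro _ ⟨x', hx', rfl⟩
        exact hN.pow_stab _ _ _ (by omega) x' hx') x hx (by
        intro p hpB hq
        apply hp p hpB
        apply hS.nondeg (r - k) (by omega)
        · exact hN.pow_stab _ _ _ (by omega) p hpB
        · intro x' hx'
          rw [hN.pow_adj]
          apply hq
          refine ⟨x', ?_, rfl⟩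
          rwa [show r - (r - k) = k by omega] at hx')
    obtain ⟨x', hx', h'⟩ := this
    refine ⟨x', h', fun h => by omega, fun j hj => ?_⟩
    obtain rfl : j = k := by omega
    exact hx'

theorem lemD (h : Pre β r B y N) {k : ℕ} (hk : 2 * k ≤ r) {x : E} (hx : x ∈ B (r - k))
    (hp : ∀ x' ∈ B k, (N ^ (r - 2 * k + 1)) x' = 0 → β x' x = 0) :
    ∃ h, (N ^ (r - 2 * k + 1)) h = x ∧ (k = 0 → h = 0) ∧ (∀ j, j + 1 = k → h ∈ B j) :=
  lemD' h.sys h.opN hk hx hp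

/-- Deforming preimages along with the operator. -/
theorem deform (h : Pre β r B y N) (hz : Op β B z) (hc : Commute N z) (hzz : z * z = 0) {k : ℕ}
    (hk : 2 * k ≤ r) (v : E) (hv : v ∈ B (r - k + 1)) :
    ∃ w : ℝ → E, ContinuousAt w 0 ∧ (∀ s, w s ∈ B k) ∧
      ∀ᶠ s in nhds (0 : ℝ), ((N + s • z) ^ (r - 2 * k + 1)) (w s) = v := by
  classical
  have hop : ∀ s : ℝ, Op β B (N + s • z) := fun s => h.opN.add (hz.smul s)
  let f : ℝ → B k →ₗ[ℝ] B (r - k + 1) := fun s =>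
    ((N + s • z) ^ (r - 2 * k + 1)).restrict (fun x hx => (hop s).pow_stab _ _ _ (by omega) x hx)
  obtain ⟨e, he1, he2⟩ := right_inv_family f 0 (by
    intro p
    rw [Topology.IsInducing.subtypeVal.continuousAt_iff]
    have : (Subtype.val ∘ fun s => f s p) = fun s =>
      (N ^ (r - 2 * k + 1)) p + (((r - 2 * k + 1 : ℕ) : ℝ) * s) • (N ^ (r - 2 * k)) (z p) := by
      funext s
      simp only [f, Function.comp, LinearMap.coe_restrict_apply]
      rw [pow_add_sq hc hzz]
      simp
    have hcont : ContinuousAt (fun s : ℝ =>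
      (N ^ (r - 2 * k + 1)) (p : E) + (((r - 2 * k + 1 : ℕ) : ℝ) * s) • (N ^ (r - 2 * k)) (z p))
      0 := by fun_prop
    rw [← this] at hcont
    exact hcont) (by
    rintro ⟨x, hx⟩
    obtain ⟨x', hx', h'⟩ := lemSurj h hk hx
    refine ⟨⟨x', hx'⟩, Subtype.ext ?_⟩
    simp [f, h'])
  refine ⟨fun s => e s ⟨v, hv⟩, ?_, ?_, ?_⟩
  · have := he1 (fun s => ⟨v, hv⟩) continuousAt_const
    exact continuous_subtype_val.continuousAt.comp this
  · intro s
    exact (e s ⟨v, hv⟩).2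
  · filter_upwards [he2] with s hs
    exact congrArg Subtype.val (hs ⟨v, hv⟩)

theorem continuous_bilin (β : E →ₗ[ℝ] E →ₗ[ℝ] ℝ) : Continuous (fun p : E × E => β p.1 p.2) := by
  let b := Module.finBasis ℝ E
  have : (fun p : E × E => β p.1 p.2) = fun p => ∑ i, b.coord i p.1 * β (b i) p.2 := by
    funext p
    conv_lhs => rw [← b.sum_repr p.1]
    simp only [map_sum, LinearMap.sum_apply, map_smul, LinearMap.smul_apply, smul_eq_mul,
      Module.Basis.coord_apply]
  rw [this]
  apply continuous_finsetSum
  intro i _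
  exact ((LinearMap.continuous_of_finiteDimensional (b.coord i)).comp continuous_fst).mul
    ((LinearMap.continuous_of_finiteDimensional (β (b i))).comp continuous_snd)

theorem cont_bilin_at (β : E →ₗ[ℝ] E →ₗ[ℝ] ℝ) {u v : ℝ → E} {s : ℝ} (hu : ContinuousAt u s)
    (hv : ContinuousAt v s) : ContinuousAt (fun s => β (u s) (v s)) s :=
  (continuous_bilin β).continuousAt.comp (hu.prodMk hv)

theorem cont_end_at (f : Module.End ℝ E) {u : ℝ → E} {s : ℝ} (hu : ContinuousAt u s) :
    ContinuousAt (fun s => f (u s)) s :=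
  (LinearMap.continuous_of_finiteDimensional f).continuousAt.comp hu

theorem lemE (h : Pre β r B y N) {k : ℕ} (hk : 2 * k ≤ r) {x : E} (hx : x ∈ B k)
    (h0 : (N ^ (r - 2 * k + 1)) x = 0) : 0 ≤ (-1) ^ k * β x ((N ^ (r - 2 * k)) x) := by
  set d := r - 2 * k with hd
  obtain ⟨w, hw1, hw2, hw3⟩ := deform h h.opy h.comm h.sq hk
    (((d + 1 : ℕ) : ℝ) • (N ^ d) (y x)) ((B _).smul_mem _
      (h.opN.pow_stab d (k + 1) _ (by omega) _ (h.opy.stab _ _ hx)))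
  rw [← hd] at hw3
  let xs : ℝ → E := fun s => x - s • w s
  have hxs : ContinuousAt xs 0 := by fun_prop
  have hlim : ContinuousAt (fun s => (-1) ^ k * β (xs s) (((N + s • y) ^ d) (xs s))) 0 := by
    have : (fun s => (-1) ^ k * β (xs s) (((N + s • y) ^ d) (xs s))) = fun s =>
        (-1) ^ k * β (xs s) ((N ^ d) (xs s) + (d * s) • (N ^ (d - 1) * y) (xs s)) := by
      funext s
      rw [pow_add_sq h.comm h.sq]
      simp
    rw [this]
    refine continuousAt_const.mul (cont_bilin_at β hxs ?_)
    refine (cont_end_at _ hxs).add (ContinuousAt.smul (by fun_prop) (cont_end_at _ hxs))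
  have hev : ∀ᶠ s in nhdsWithin (0 : ℝ) (Set.Ioi 0),
      0 ≤ (-1) ^ k * β (xs s) (((N + s • y) ^ d) (xs s)) := by
    filter_upwards [nhdsWithin_le_nhds hw3, self_mem_nhdsWithin] with s hs hs0
    by_cases hne : xs s = 0
    · simp [hne]
    · refine (h.hr s hs0 k hk (xs s) ((B k).sub_mem hx ((B k).smul_mem _ (hw2 s))) ?_ hne).le
      rw [← hd]
      simp only [xs, map_sub, map_smul, hs]
      rw [pow_add_sq h.comm h.sq]
      simp only [LinearMap.add_apply, h0, zero_add, LinearMap.smul_apply, Nat.add_sub_cancel,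
        Module.End.mul_apply]
      module
  have h2 := ge_of_tendsto (hlim.tendsto.mono_left nhdsWithin_le_nhds) hev
  simpa [xs] using h2

theorem quad_zero {b q : ℝ} (h : ∀ l : ℝ, 0 ≤ l * b + l ^ 2 * q) : b = 0 := by
  have hq : 0 ≤ q := by nlinarith [h 1, h (-1)]
  by_contra hb
  have := h (-b / (2 * (q + 1)))
  have hq1 : 0 < q + 1 := by linarith
  have e : -b / (2 * (q + 1)) * b + (-b / (2 * (q + 1))) ^ 2 * q =
      -(b ^ 2 * (q + 2)) / (4 * (q + 1) ^ 2) := by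
    field_simp
    ring
  rw [e] at this
  have hb2 : 0 < b ^ 2 := by positivity
  have : 0 < (b ^ 2 * (q + 2)) / (4 * (q + 1) ^ 2) := by positivity
  rw [neg_div] at *
  linarith

theorem lemF (h : Pre β r B y N) {k : ℕ} (hk : 2 * k ≤ r) {x : E} (hx : x ∈ B k)
    (h0 : (N ^ (r - 2 * k + 1)) x = 0) (hn : β x ((N ^ (r - 2 * k)) x) = 0) :
    ∃ g u, x = N g + u ∧ u ∈ T0 r B N k ∧ (k = 0 → g = 0) ∧
      (∀ j, j + 1 = k → g ∈ T0 r B N j) := by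
  set d := r - 2 * k with hd
  obtain ⟨g, hg1, hg2, hg3⟩ := lemD h hk (x := (N ^ d) x)
    (h.opN.pow_stab d _ _ (by omega) _ hx) (by
    intro x' hx' hx0
    rw [← hd] at hx0
    have key : ∀ l : ℝ, 0 ≤ l * ((-1) ^ k * (2 * β x' ((N ^ d) x))) +
        l ^ 2 * ((-1) ^ k * β x' ((N ^ d) x')) := by
      intro l
      have := lemE h hk (x := x + l • x') ((B k).add_mem hx ((B k).smul_mem _ hx'))
        (by rw [← hd]; simp [h0, hx0])
      rw [← hd] at this
      simp only [map_add, map_smul, LinearMap.add_apply, LinearMap.smul_apply, hn,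
        smul_eq_mul] at this
      have e : β x ((N ^ d) x') = β x' ((N ^ d) x) := by rw [← h.opN.pow_adj, h.sys.symm]
      rw [e] at this
      linarith
    have := quad_zero key
    have hs : ((-1 : ℝ)) ^ k ≠ 0 := by simp
    simpa using this)
  rw [← hd] at hg1
  refine ⟨g, x - N g, by abel, ?_, hg2, ?_⟩
  · rw [mem_T0]
    constructor
    · refine (B k).sub_mem hx ?_
      rcases k with _ | k
      · rw [hg2 rfl, map_zero]; exact (B _).zero_mem
      · exact h.opN.stab _ _ (hg3 k rfl)
    · rw [← hd, map_sub, pow_app_succ, hg1, sub_self]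
  · intro j hj
    rw [mem_T0]
    refine ⟨hg3 j hj, ?_⟩
    rw [show r - 2 * j = (d + 1) + 1 by omega, ← app_pow_succ, hg1, app_pow_succ, h0]

theorem expand_aux {A : ℝ} {R : ℝ → ℝ} (hR : ContinuousAt R 0)
    (h : ∀ᶠ s in nhds (0 : ℝ), 0 ≤ s * (A + s * R s)) : A = 0 ∧ 0 ≤ R 0 := by
  have hc : ContinuousAt (fun s => A + s * R s) 0 := by fun_prop
  have hA1 : 0 ≤ A := by
    have h1 : ∀ᶠ s in nhdsWithin (0 : ℝ) (Set.Ioi 0), 0 ≤ A + s * R s := by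
      filter_upwards [nhdsWithin_le_nhds h, self_mem_nhdsWithin] with s hs hs0
      exact nonneg_of_mul_nonneg_right hs hs0
    simpa using ge_of_tendsto (hc.tendsto.mono_left nhdsWithin_le_nhds) h1
  have hA2 : A ≤ 0 := by
    have h1 : ∀ᶠ s in nhdsWithin (0 : ℝ) (Set.Iio 0), A + s * R s ≤ 0 := by
      filter_upwards [nhdsWithin_le_nhds h, self_mem_nhdsWithin] with s hs hs0
      have hs0 : s < 0 := hs0
      by_contra hcon
      push Not at hcon
      nlinarith
    simpa using le_of_tendsto (hc.tendsto.mono_left nhdsWithin_le_nhds) h1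
  have hA : A = 0 := le_antisymm hA2 hA1
  refine ⟨hA, ?_⟩
  have h1 : ∀ᶠ s in nhdsWithin (0 : ℝ) (Set.Ioi 0), 0 ≤ R s := by
    filter_upwards [nhdsWithin_le_nhds h, self_mem_nhdsWithin] with s hs hs0
    have hs0 : 0 < s := hs0
    rw [hA, zero_add] at hs
    exact nonneg_of_mul_nonneg_right (nonneg_of_mul_nonneg_right hs hs0) hs0
  exact ge_of_tendsto (hR.tendsto.mono_left nhdsWithin_le_nhds) h1

/-- `z` is an infinitesimally admissible direction at `N`. -/
structure Adm (β : E →ₗ[ℝ] E →ₗ[ℝ] ℝ) (r : ℕ) (B : ℕ → Submodule ℝ E)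
    (y N z : Module.End ℝ E) : Prop where
  op : Op β B z
  comm : Commute N z
  sq : z * z = 0
  pre : ∀ᶠ s in nhds (0 : ℝ), Pre β r B y (N + s • z)

theorem lemG (h : Pre β r B y N) (hz : Adm β r B y N z) {k : ℕ} (hk : 2 * k < r) {a : E}
    (ha : a ∈ T0 r B N k) {x' : E} (hx : x' ∈ B k) (h0 : (N ^ (r - 2 * k + 1)) x' = 0) :
    β a ((N ^ (r - 2 * k - 1)) (z a)) = 0 ∧ β x' ((N ^ (r - 2 * k - 1)) (z a)) = 0 := by
  obtain ⟨haB, haN⟩ := mem_T0.1 ha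
  set d := r - 2 * k with hd
  have main : ∀ x' ∈ B k, (N ^ (d + 1)) x' = 0 →
      (-1) ^ k * (d * β a ((N ^ (d - 1)) (z a))) = 0 ∧
      0 ≤ (-1) ^ k * (2 * d * β x' ((N ^ (d - 1)) (z a)) + β x' ((N ^ d) x')) := by
    intro x' hx h0
    obtain ⟨w, hw1, hw2, hw3⟩ := deform h hz.op hz.comm hz.sq hk.le
      (((d + 1 : ℕ) : ℝ) • (N ^ d) (z x')) ((B _).smul_mem _
        (h.opN.pow_stab d (k + 1) _ (by omega) _ (hz.op.stab _ _ hx)))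
    rw [← hd] at hw3
    let v : ℝ → E := fun s => x' - s • w s
    have hv : ContinuousAt v 0 := by fun_prop
    let R : ℝ → ℝ := fun s => (-1) ^ k * (2 * d * β (v s) ((N ^ (d - 1)) (z a)) +
      β (v s) ((N ^ d) (v s) + (d * s) • (N ^ (d - 1) * z) (v s)))
    have hR : ContinuousAt R 0 := by
      refine continuousAt_const.mul ((continuousAt_const.mul
        (cont_bilin_at β hv continuousAt_const)).add (cont_bilin_at β hv ?_))
      refine (cont_end_at _ hv).add (ContinuousAt.smul (by fun_prop) (cont_end_at _ hv))
    have := expand_aux (A := (-1) ^ k * (d * β a ((N ^ (d - 1)) (z a)))) hR (by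
      filter_upwards [hw3, hz.pre] with s hs hpre
      have hE := lemE hpre hk.le (x := a + s • v s) ((B k).add_mem haB ((B k).smul_mem _
        ((B k).sub_mem hx ((B k).smul_mem _ (hw2 s))))) (by
        rw [← hd]
        simp only [v, map_add, map_smul, map_sub, hs]
        have hza : (N ^ d) (z a) = 0 := by rw [pow_app_comm hz.comm, haN, map_zero]
        have haN' : (N ^ (d + 1)) a = 0 := pow_zero_of_le (Nat.le_succ _) haN
        rw [pow_add_sq hz.comm hz.sq]
        simp only [LinearMap.add_apply, h0, haN', zero_add, LinearMap.smul_apply,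
          Nat.add_sub_cancel, Module.End.mul_apply, hza]
        module)
      rw [← hd] at hE
      have hadj := hpre.opN.pow_adj d
      have e1 : ((N + s • z) ^ d) a = (d * s) • (N ^ (d - 1)) (z a) := by
        rw [pow_add_sq hz.comm hz.sq]; simp [haN]
      have e2 : β a (((N + s • z) ^ d) (v s)) = d * s * β (v s) ((N ^ (d - 1)) (z a)) := by
        rw [← hadj, e1, h.sys.symm]; simp
      simp only [map_add, map_smul, LinearMap.add_apply, LinearMap.smul_apply, e1, e2,
        smul_eq_mul] at hE
      convert hE using 1
      simp only [R, pow_add_sq hz.comm hz.sq, map_add, LinearMap.add_apply, LinearMap.smul_apply,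
        map_smul, smul_eq_mul]
      ring)
    simpa [R, v] using this
  have hd0 : (d : ℝ) ≠ 0 := by
    have : d ≠ 0 := by omega
    exact_mod_cast this
  have hs : ((-1 : ℝ)) ^ k ≠ 0 := by simp
  constructor
  · have := (main x' hx h0).1
    simpa [hs, hd0] using this
  · have key : ∀ l : ℝ, 0 ≤ l * ((-1) ^ k * (2 * d * β x' ((N ^ (d - 1)) (z a)))) +
        l ^ 2 * ((-1) ^ k * β x' ((N ^ d) x')) := by
      intro l
      have := (main (l • x') ((B k).smul_mem _ hx) (by simp [h0])).2
      simp only [map_smul, LinearMap.smul_apply, smul_eq_mul] at this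
      linarith
    have := quad_zero key
    simpa [hs, hd0] using this

/-- `N`-saturation of the family `T0`. -/
def TT (r : ℕ) (B : ℕ → Submodule ℝ E) (N : Module.End ℝ E) : ℕ → Submodule ℝ E
  | 0 => T0 r B N 0
  | j + 1 => T0 r B N (j + 1) ⊔ (TT r B N j).map N

theorem T0_le_TT (k : ℕ) : T0 r B N k ≤ TT r B N k := by
  cases k with
  | zero => exact le_rfl
  | succ k => exact le_sup_left

theorem TT_map {j : ℕ} {x : E} (hx : x ∈ TT r B N j) : N x ∈ TT r B N (j + 1) :=
  Submodule.mem_sup_right ⟨x, hx, rfl⟩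

theorem TT_le (hN : Op β B N) (j : ℕ) : TT r B N j ≤ B j := by
  induction j with
  | zero => exact inf_le_left
  | succ j ih =>
    refine sup_le inf_le_left ?_
    rintro _ ⟨x, hx, rfl⟩
    exact hN.stab _ _ (ih hx)

theorem TT_decomp (j : ℕ) (x : E) (hx : x ∈ TT r B N j) :
    ∃ a : ℕ → E, (∀ k, a k ∈ T0 r B N k) ∧ x = ∑ k ∈ Finset.range (j + 1), (N ^ (j - k)) (a k) := by
  induction j generalizing x with
  | zero => 
    refine ⟨fun k => if k = 0 then x else 0, ?_, ?_⟩
    · intro k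
      by_cases hk : k = 0
      · subst hk; exact hx
      · simp [hk]
    · simp
  | succ j ih =>
    obtain ⟨u, hu, _, ⟨t, ht, rfl⟩, rfl⟩ := Submodule.mem_sup.1 hx
    obtain ⟨a, ha, rfl⟩ := ih t ht
    refine ⟨fun k => if k = j + 1 then u else a k, ?_, ?_⟩
    · intro k
      by_cases hk : k = j + 1
      · subst hk; simpa using hu
      · simpa [hk] using ha k
    · rw [Finset.sum_range_succ _ (j + 1), map_sum, add_comm]
      congr 1
      · apply Finset.sum_congr rfl
        intro k hk
        have hk := Finset.mem_range.1 hk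
        have hk' : k ≠ j + 1 := by omega
        simp only [hk', if_false]
        rw [app_pow_succ, show j - k + 1 = j + 1 - k by omega]
      · simp

theorem lemH0 (h : Pre β r B y N) (hz : Adm β r B y N z) {k : ℕ} {a : E}
    (ha : a ∈ T0 r B N k) : z a ∈ TT r B N (k + 1) := by
  obtain ⟨haB, haN⟩ := mem_T0.1 ha
  by_cases hk : 2 * k < r
  swap
  · rw [show r - 2 * k = 0 by omega] at haN
    have : a = 0 := by simpa using haN
    rw [this, map_zero]; exact (TT r B N _).zero_mem
  obtain ⟨g, hg1, hg2, hg3⟩ := lemD h hk.le (x := (N ^ (r - 2 * k - 1)) (z a))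
    (h.opN.pow_stab _ (k + 1) _ (by omega) _ (hz.op.stab _ _ haB))
    (fun x' hx' h0 => (lemG h hz hk ha hx' h0).2)
  have hgT : ∀ j, j + 1 = k → g ∈ T0 r B N j := by
    intro j hj
    rw [mem_T0]
    refine ⟨hg3 j hj, ?_⟩
    rw [show r - 2 * j = (r - 2 * k + 1) + 1 by omega, ← app_pow_succ, hg1, app_pow_succ,
      show r - 2 * k - 1 + 1 = r - 2 * k by omega, pow_app_comm hz.comm, haN, map_zero]
  have hNNg : N (N g) ∈ TT r B N (k + 1) := by
    rcases k with _ | k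
    · rw [hg2 rfl]; simp
    · exact TT_map (TT_map (T0_le_TT _ (hgT k rfl)))
  suffices hp : z a - N (N g) ∈ TT r B N (k + 1) by
    have := (TT r B N (k + 1)).add_mem hp hNNg
    simpa using this
  have hNg : N g ∈ B k := by
    rcases k with _ | k
    · rw [hg2 rfl]; simp
    · exact h.opN.stab _ _ (hg3 k rfl)
  have hpN : (N ^ (r - 2 * k - 1)) (z a - N (N g)) = 0 := by
    rw [map_sub, pow_app_succ, pow_app_succ, ← hg1,
      show r - 2 * k - 1 + 1 + 1 = r - 2 * k + 1 by omega, sub_self]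
  have hpB : z a - N (N g) ∈ B (k + 1) :=
    (B _).sub_mem (hz.op.stab _ _ haB) (h.opN.stab _ _ hNg)
  by_cases hk2 : 2 * (k + 1) ≤ r
  · obtain ⟨g', u, hgu, hu, -, hg'⟩ := lemF h hk2 hpB (by
      rw [show r - 2 * (k + 1) + 1 = r - 2 * k - 1 by omega, hpN]) (by
      set m := r - 2 * (k + 1) with hm
      have e0 : (N ^ m) (N (N g)) = (N ^ (r - 2 * k)) g := by
        rw [pow_app_succ, pow_app_succ, show m + 1 + 1 = r - 2 * k by omega]
      have hzz : ∀ b, z (z b) = 0 := fun b => by rw [← Module.End.mul_apply, hz.sq]; simp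
      -- the pairing of `z a` with `N^m (z a)` vanishes
      have e1 : β (z a) ((N ^ m) (z a)) = 0 := by
        rw [hz.op.adj, pow_app_comm hz.comm, hzz, map_zero]
      have e2 : β (z a) ((N ^ m) (N (N g))) = 0 := by
        rw [e0, hz.op.adj, ← pow_app_comm hz.comm, ← h.opN.pow_adj, haN]
        simp
      have e3 : β (N (N g)) ((N ^ m) (N (N g))) = 0 := by
        have : β (N (N g)) ((N ^ m) (N (N g))) = β (N (N g)) ((N ^ m) (z a)) := by
          rw [e0, h.opN.adj, h.opN.adj, h.opN.adj, h.opN.adj, app_pow_succ, app_pow_succ,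
            app_pow_succ, app_pow_succ, show m + 1 + 1 = (r - 2 * k - 1) + 1 by omega,
            ← app_pow_succ, hg1, app_pow_succ]
        rw [this, ← h.opN.pow_adj, h.sys.symm, e2]
      have e4 : β (N (N g)) ((N ^ m) (z a)) = 0 := by
        rw [← h.opN.pow_adj, h.sys.symm, e2]
      simp [e1, e2, e3, e4])
    rw [hgu]
    exact (TT r B N _).add_mem (TT_map (T0_le_TT _ (hg' k rfl))) (T0_le_TT _ hu)
  · rw [show r - 2 * k - 1 = 0 by omega] at hpN
    have : z a - N (N g) = 0 := by simpa using hpN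
    rw [this]; exact (TT r B N _).zero_mem

theorem lemH (h : Pre β r B y N) (hz : Adm β r B y N z) {k : ℕ} {a : E}
    (ha : a ∈ TT r B N k) : z a ∈ TT r B N (k + 1) := by
  induction k generalizing a with
  | zero => exact lemH0 h hz ha
  | succ k ih =>
    obtain ⟨u, hu, _, ⟨t, ht, rfl⟩, rfl⟩ := Submodule.mem_sup.1 ha
    rw [map_add]
    refine (TT r B N _).add_mem (lemH0 h hz hu) ?_
    have : z (N t) = N (z t) := by
      rw [← Module.End.mul_apply, ← Module.End.mul_apply, hz.comm.eq]
    rw [this]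
    exact TT_map (ih ht)

theorem T0_pow_zero {k m : ℕ} {a : E} (ha : a ∈ T0 r B N k) (hm : r - 2 * k ≤ m) :
    (N ^ m) a = 0 := pow_zero_of_le hm (mem_T0.1 ha).2

theorem TT_top {j : ℕ} (hj : r ≤ j) {x : E} (hx : x ∈ TT r B N j) : x = 0 := by
  obtain ⟨a, ha, rfl⟩ := TT_decomp j x hx
  apply Finset.sum_eq_zero
  intro k hk
  have := Finset.mem_range.1 hk
  exact T0_pow_zero (ha k) (by omega)

theorem TT_perp (h : Pre β r B y N) {i j : ℕ} (hij : i + j = r) {x x' : E} (hx : x ∈ TT r B N i)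
    (hx' : x' ∈ TT r B N j) : β x x' = 0 := by
  obtain ⟨a, ha, rfl⟩ := TT_decomp i x hx
  obtain ⟨b, hb, rfl⟩ := TT_decomp j x' hx'
  rw [map_sum]
  apply Finset.sum_eq_zero
  intro l hl
  rw [map_sum, LinearMap.sum_apply]
  apply Finset.sum_eq_zero
  intro k hk
  have := Finset.mem_range.1 hk
  have := Finset.mem_range.1 hl
  rcases le_total k l with hkl | hkl
  · rw [h.opN.pow_adj, pow_app_add, T0_pow_zero (hb l) (by omega), map_zero]
  · rw [← h.opN.pow_adj, pow_app_add, T0_pow_zero (ha k) (by omega), map_zero,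
      LinearMap.zero_apply]

theorem lemJ (h : Pre β r B y N) {i j : ℕ} (hij : i + j + 1 = r) {x : E} (hx : x ∈ TT r B N i)
    (hp : ∀ x' ∈ TT r B N j, β x (y x') = 0) : x = 0 := by
  obtain ⟨a, ha, rfl⟩ := TT_decomp i x hx
  apply Finset.sum_eq_zero
  intro k hk
  have hki := Finset.mem_range.1 hk
  by_cases hjk : k ≤ j
  swap
  · exact T0_pow_zero (ha k) (by omega)
  suffices a k = 0 by rw [this, map_zero]
  have hmem : ∀ m, (N ^ m) (a k) ∈ TT r B N (k + m) := by
    intro m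
    induction m with
    | zero => simpa using T0_le_TT _ (ha k)
    | succ m ih => rw [← app_pow_succ]; exact TT_map ih
  have h1 := hp ((N ^ (j - k)) (a k)) (by
    have := hmem (j - k)
    rwa [show k + (j - k) = j by omega] at this)
  rw [map_sum, LinearMap.sum_apply, Finset.sum_eq_single k] at h1
  · by_contra hne
    have h2 := lemB h (k := k) (by omega) (ha k) hne
    rw [h.opN.pow_adj, ← pow_app_comm h.comm, pow_app_add,
      show i - k + (j - k) = r - 2 * k - 1 by omega] at h1
    rw [h1] at h2
    simp at h2
  · intro l hl hlk
    have hli := Finset.mem_range.1 hl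
    rcases lt_or_gt_of_ne hlk with hlt | hlt
    · rw [h.opN.pow_adj, pow_app_comm h.comm, pow_app_add, T0_pow_zero (ha k) (by omega), map_zero,
        map_zero]
    · rw [← pow_app_comm h.comm, ← h.opN.pow_adj, pow_app_add, T0_pow_zero (ha l) (by omega),
        map_zero, LinearMap.zero_apply]
  · intro hk'; exact absurd hk hk'

/-- The subfamily generated by `TT` and `y`. -/
def ZZ (r : ℕ) (B : ℕ → Submodule ℝ E) (y N : Module.End ℝ E) : ℕ → Submodule ℝ E
  | 0 => TT r B N 0
  | j + 1 => TT r B N (j + 1) ⊔ (TT r B N j).map y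

theorem TT_le_ZZ (k : ℕ) : TT r B N k ≤ ZZ r B y N k := by
  cases k with
  | zero => exact le_rfl
  | succ k => exact le_sup_left

theorem ZZ_le (h : Pre β r B y N) (j : ℕ) : ZZ r B y N j ≤ B j := by
  cases j with
  | zero => exact TT_le h.opN 0
  | succ j =>
    refine sup_le (TT_le h.opN _) ?_
    rintro _ ⟨x, hx, rfl⟩
    exact h.opy.stab _ _ (TT_le h.opN _ hx)

theorem ZZ_y (h : Pre β r B y N) {j : ℕ} {x : E} (hx : x ∈ ZZ r B y N j) :
    y x ∈ ZZ r B y N (j + 1) := by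
  cases j with
  | zero => exact Submodule.mem_sup_right ⟨x, hx, rfl⟩
  | succ j =>
    obtain ⟨u, hu, _, ⟨t, ht, rfl⟩, rfl⟩ := Submodule.mem_sup.1 hx
    rw [map_add, ← Module.End.mul_apply y y, h.sq, LinearMap.zero_apply, add_zero]
    exact Submodule.mem_sup_right ⟨u, hu, rfl⟩

theorem ZZ_z (h : Pre β r B y N) (hz : Adm β r B y N z) (hc : Commute z y) {j : ℕ} {x : E}
    (hx : x ∈ ZZ r B y N j) : z x ∈ ZZ r B y N (j + 1) := by
  cases j with
  | zero => exact TT_le_ZZ _ (lemH h hz hx)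
  | succ j =>
    obtain ⟨u, hu, _, ⟨t, ht, rfl⟩, rfl⟩ := Submodule.mem_sup.1 hx
    rw [map_add]
    refine (ZZ r B y N _).add_mem (TT_le_ZZ _ (lemH h hz hu)) ?_
    rw [← Module.End.mul_apply, hc.eq, Module.End.mul_apply]
    exact Submodule.mem_sup_right ⟨z t, lemH h hz ht, rfl⟩

theorem ZZ_nondeg (h : Pre β r B y N) {i j : ℕ} (hij : i + j = r) {x : E} (hx : x ∈ ZZ r B y N i)
    (hp : ∀ x' ∈ ZZ r B y N j, β x x' = 0) : x = 0 := by
  have hT : ∀ u ∈ TT r B N i, (∀ x' ∈ ZZ r B y N j, β u x' = 0) → u = 0 := by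
    intro u hu hp
    cases j with
    | zero => exact TT_top (by omega) hu
    | succ j =>
      apply lemJ h (j := j) (by omega) hu
      intro x' hx'
      exact hp _ (Submodule.mem_sup_right ⟨x', hx', rfl⟩)
  cases i with
  | zero => exact hT x hx hp
  | succ i =>
    obtain ⟨u, hu, _, ⟨t, ht, rfl⟩, rfl⟩ := Submodule.mem_sup.1 hx
    have ht0 : t = 0 := by
      apply lemJ h (j := j) (by omega) ht
      intro x' hx'
      have := hp x' (TT_le_ZZ _ hx')
      rw [map_add, LinearMap.add_apply, TT_perp h hij hu hx', zero_add, h.opy.adj] at this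
      exact this
    rw [ht0, map_zero, add_zero] at hp ⊢
    exact hT u hu hp

/-- The orthogonal complement of `ZZ`. -/
def BB (β : E →ₗ[ℝ] E →ₗ[ℝ] ℝ) (r : ℕ) (B : ℕ → Submodule ℝ E) (y N : Module.End ℝ E) (k : ℕ) :
    Submodule ℝ E where
  carrier := {x | x ∈ B k ∧ ∀ w ∈ ZZ r B y N (r - k), β w x = 0}
  add_mem' := by
    rintro a b ⟨h1, h2⟩ ⟨h3, h4⟩
    exact ⟨(B k).add_mem h1 h3, fun w hw => by rw [map_add, h2 w hw, h4 w hw, add_zero]⟩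
  zero_mem' := ⟨(B k).zero_mem, fun w _ => map_zero _⟩
  smul_mem' := by
    rintro c a ⟨h1, h2⟩
    exact ⟨(B k).smul_mem _ h1, fun w hw => by rw [map_smul, h2 w hw, smul_zero]⟩

theorem BB_le (k : ℕ) : BB β r B y N k ≤ B k := fun _ hx => hx.1

theorem BB_stab (h : Pre β r B y N) (hz : Op β B z)
    (hZ : ∀ j x, x ∈ ZZ r B y N j → z x ∈ ZZ r B y N (j + 1)) (k : ℕ) (x : E)
    (hx : x ∈ BB β r B y N k) : z x ∈ BB β r B y N (k + 1) := by
  refine ⟨hz.stab _ _ hx.1, ?_⟩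
  intro w hw
  by_cases hk : k + 1 ≤ r
  · rw [← hz.adj]
    apply hx.2
    have := hZ _ w hw
    rwa [show r - (k + 1) + 1 = r - k by omega] at this
  · rw [h.sys.top (k + 1) (by omega) _ (hz.stab _ _ hx.1), map_zero]

theorem BB_inf (h : Pre β r B y N) {k : ℕ} (hk : k ≤ r) {x : E} (hx : x ∈ BB β r B y N k)
    (hx' : x ∈ ZZ r B y N k) : x = 0 := by
  apply ZZ_nondeg h (j := r - k) (by omega) hx'
  intro w hw
  rw [h.sys.symm]
  exact hx.2 w hw

theorem BB_decomp (h : Pre β r B y N) {k : ℕ} (hk : k ≤ r) {x : E} (hx : x ∈ B k) :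
    ∃ w ∈ ZZ r B y N k, ∃ b ∈ BB β r B y N k, x = w + b := by
  obtain ⟨w, hw, hw'⟩ := riesz β (ZZ r B y N k) (ZZ r B y N (r - k))
    (fun p hp hq => ZZ_nondeg h (j := r - k) (by omega) hp hq)
    (fun q hq hp => ZZ_nondeg h (j := k) (by omega) hq (fun p hp' => by
      rw [h.sys.symm]; exact hp p hp')) (β x)
  refine ⟨w, hw, x - w, ⟨(B k).sub_mem hx (ZZ_le h _ hw), ?_⟩, by abel⟩
  intro q hq
  rw [h.sys.symm, map_sub, LinearMap.sub_apply, hw' q hq, sub_self]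

theorem BB_nondeg (h : Pre β r B y N) {k : ℕ} (hk : k ≤ r) {x : E} (hx : x ∈ BB β r B y N k)
    (hp : ∀ x' ∈ BB β r B y N (r - k), β x x' = 0) : x = 0 := by
  apply h.sys.nondeg k hk x hx.1
  intro x' hx'
  obtain ⟨w, hw, b, hb, rfl⟩ := BB_decomp h (by omega) hx'
  rw [map_add, hp b hb, add_zero, h.sys.symm, hx.2 w hw]

variable {ι : Type} [Fintype ι] [DecidableEq ι]

/-- Weighted sum of the basic operators. -/
def LL (y : ι → Module.End ℝ E) (c : ι → ℝ) : Module.End ℝ E := ∑ i, c i • y i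

/-- Standing assumptions on the basic operators. -/
structure Alg (β : E →ₗ[ℝ] E →ₗ[ℝ] ℝ) (y : ι → Module.End ℝ E) : Prop where
  symm : ∀ a b, β a b = β b a
  comm : ∀ i j, Commute (y i) (y j)
  sq : ∀ i, y i * y i = 0
  adj : ∀ i a b, β (y i a) b = β a (y i b)

structure Good (β : E →ₗ[ℝ] E →ₗ[ℝ] ℝ) (y : ι → Module.End ℝ E) (r : ℕ) (S : Finset ι)
    (B : ℕ → Submodule ℝ E) : Prop where
  stab : ∀ i ∈ S, ∀ k x, x ∈ B k → y i x ∈ B (k + 1)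
  top : ∀ k, r < k → ∀ x ∈ B k, x = 0
  nondeg : ∀ k, k ≤ r → ∀ x ∈ B k, (∀ x' ∈ B (r - k), β x x' = 0) → x = 0
  hr : ∀ c : ι → ℝ, (∀ i ∈ S, 0 < c i) → (∀ i, i ∉ S → c i = 0) → HR β r B (LL y c)

variable {y : ι → Module.End ℝ E} {S : Finset ι}

theorem LL_comm (hA : Alg β y) (c : ι → ℝ) (i : ι) : Commute (LL y c) (y i) :=
  Commute.sum_left _ _ _ (fun j _ => (hA.comm j i).smul_left (c j))

theorem LL_add (c : ι → ℝ) (s : ℝ) (i : ι) :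
    LL y c + s • y i = LL y (c + s • Pi.single i 1) := by
  simp only [LL, Pi.add_apply, add_smul, Finset.sum_add_distrib]
  congr 1
  rw [Finset.sum_eq_single i]
  · simp
  · intro j _ hj; simp [hj]
  · simp

theorem LL_mem (c : ι → ℝ) (hc : ∀ i, i ∉ S → c i = 0) (C : Submodule ℝ E) (x : E)
    (h : ∀ i ∈ S, y i x ∈ C) : LL y c x ∈ C := by
  simp only [LL, LinearMap.sum_apply, LinearMap.smul_apply]
  apply C.sum_mem
  intro i _
  by_cases hi : i ∈ S
  · exact C.smul_mem _ (h i hi)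
  · simp [hc i hi]

theorem LL_op (hA : Alg β y) (c : ι → ℝ) (hc : ∀ i, i ∉ S → c i = 0)
    (hB : ∀ i ∈ S, ∀ k x, x ∈ B k → y i x ∈ B (k + 1)) : Op β B (LL y c) := by
  refine ⟨?_, fun k x hx => LL_mem c hc _ x (fun i hi => hB i hi k x hx)⟩
  intro a b
  simp [LL, hA.adj]

theorem Good.pre (hA : Alg β y) (hG : Good β y r S B) {e : ι} (he : e ∈ S) {c : ι → ℝ}
    (hc : ∀ i ∈ S.erase e, 0 < c i) (hc0 : ∀ i, i ∉ S.erase e → c i = 0) :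
    Pre β r B (y e) (LL y c) := by
  have hc0' : ∀ i, i ∉ S → c i = 0 := fun i hi => hc0 i (fun h => hi (Finset.mem_of_mem_erase h))
  refine ⟨⟨hA.symm, hG.top, hG.nondeg⟩, LL_op hA c hc0' hG.stab,
    ⟨hA.adj e, hG.stab e he⟩, LL_comm hA c e, hA.sq e, ?_⟩
  intro t ht
  rw [LL_add]
  apply hG.hr
  · intro i hi
    by_cases hie : i = e
    · subst hie
      simp [hc0 i (by simp), ht]
    · have := hc i (Finset.mem_erase.2 ⟨hie, hi⟩)
      simpa [hie] using this
  · intro i hi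
    have hie : i ≠ e := fun h => hi (h ▸ he)
    simp [hie, hc0' i hi]

theorem Good.adm (hA : Alg β y) (hG : Good β y r S B) {e : ι} (he : e ∈ S) {c : ι → ℝ}
    (hc : ∀ i ∈ S.erase e, 0 < c i) (hc0 : ∀ i, i ∉ S.erase e → c i = 0) {i : ι}
    (hi : i ∈ S.erase e) : Adm β r B (y e) (LL y c) (y i) := by
  refine ⟨⟨hA.adj i, hG.stab i (Finset.mem_of_mem_erase hi)⟩, LL_comm hA c i, hA.sq i, ?_⟩
  have : ∀ᶠ s in nhds (0 : ℝ), -c i < s := lt_mem_nhds (by simpa using hc i hi)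
  filter_upwards [this] with s hs
  rw [LL_add]
  apply hG.pre hA he
  · intro j hj
    by_cases hji : j = i
    · subst hji; simp; linarith
    · simpa [hji] using hc j hj
  · intro j hj
    have hji : j ≠ i := fun h => hj (h ▸ hi)
    simp [hji, hc0 j hj]

theorem delete_K (hA : Alg β y) (hG : Good β y r S B) {e : ι} (he : e ∈ S) {c c' : ι → ℝ}
    (hc : ∀ i ∈ S.erase e, 0 < c i) (hc0 : ∀ i, i ∉ S.erase e → c i = 0)
    (hc' : ∀ i ∈ S.erase e, 0 < c' i) (hc0' : ∀ i, i ∉ S.erase e → c' i = 0)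
    (k : ℕ) (hk : 2 * k ≤ r) (x : E) (hx : x ∈ BB β r B (y e) (LL y c) k)
    (h0 : (LL y c' ^ (r - 2 * k)) x = 0) : x = 0 := by
  have hp := hG.pre hA he hc hc0
  have hp' := hG.pre hA he hc' hc0'
  have had := fun i hi => hG.adm hA he hc hc0 (i := i) hi
  have had' := fun i hi => hG.adm hA he hc' hc0' (i := i) hi
  have hZs : ∀ i ∈ S.erase e, ∀ j x, x ∈ ZZ r B (y e) (LL y c) j →
      y i x ∈ ZZ r B (y e) (LL y c) (j + 1) :=
    fun i hi j x hx => ZZ_z hp (had i hi) (hA.comm i e) hx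
  have hBs : ∀ i ∈ S.erase e, ∀ k x, x ∈ BB β r B (y e) (LL y c) k →
      y i x ∈ BB β r B (y e) (LL y c) (k + 1) :=
    fun i hi => BB_stab hp (had i hi).op (hZs i hi)
  have oZ := LL_op hA c' hc0' hZs
  have oB := LL_op hA c' hc0' hBs
  have oBN := LL_op hA c hc0 hBs
  have oT := LL_op (B := TT r B (LL y c')) hA c hc0 (fun i hi k x hx => lemH hp' (had' i hi) hx)
  induction k using Nat.strong_induction_on generalizing x with
  | _ k ih =>
  have hxT : x ∈ T0 r B (LL y c') k := mem_T0.2 ⟨hx.1, h0⟩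
  have h1 : (LL y c ^ (r - 2 * k)) x ∈ TT r B (LL y c') (r - k) :=
    oT.pow_stab _ k _ (by omega) x (T0_le_TT _ hxT)
  have h2 : (LL y c ^ (r - 2 * k)) x ∈ ZZ r B (y e) (LL y c) (r - k) := by
    obtain ⟨a, ha, hsum⟩ := TT_decomp _ _ h1
    rw [hsum]
    apply Submodule.sum_mem
    intro j hj
    have hj := Finset.mem_range.1 hj
    by_cases hjk : k ≤ j
    · rw [T0_pow_zero (ha j) (by omega)]; exact Submodule.zero_mem _
    · apply oZ.pow_stab _ j _ (by omega)
      obtain ⟨w, hw, b, hb, hab⟩ := BB_decomp hp (k := j) (by omega) (mem_T0.1 (ha j)).1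
      have hb0 : b = 0 := by
        apply ih j (by omega) (by omega) b hb
        apply BB_inf hp (k := r - j) (by omega) (oB.pow_stab _ j _ (by omega) b hb)
        have : (LL y c' ^ (r - 2 * j)) b = - (LL y c' ^ (r - 2 * j)) w := by
          have := (mem_T0.1 (ha j)).2
          rw [hab, map_add] at this
          exact eq_neg_of_add_eq_zero_right this
        rw [this]
        exact Submodule.neg_mem _ (oZ.pow_stab _ j _ (by omega) w hw)
      rw [hab, hb0, add_zero]
      exact hw
  have h3 : (LL y c ^ (r - 2 * k)) x = 0 :=
    BB_inf hp (by omega) (oBN.pow_stab _ k _ (by omega) x hx) h2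
  exact BB_inf hp (by omega) hx (TT_le_ZZ _ (T0_le_TT _ (mem_T0.2 ⟨hx.1, h3⟩)))

theorem delete (hA : Alg β y) (hG : Good β y r S B) {e : ι} (he : e ∈ S) {c : ι → ℝ}
    (hc : ∀ i ∈ S.erase e, 0 < c i) (hc0 : ∀ i, i ∉ S.erase e → c i = 0) {o : E} (ho : o ∈ B 0)
    (hB0 : B 0 ≤ Submodule.span ℝ {o}) (hor : (LL y c ^ r) o ≠ 0) :
    ∃ B' : ℕ → Submodule ℝ E, Good β y r (S.erase e) B' ∧ o ∈ B' 0 ∧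
      B' 0 ≤ Submodule.span ℝ {o} := by
  have hp := hG.pre hA he hc hc0
  have had := fun i hi => hG.adm hA he hc hc0 (i := i) hi
  have hZs : ∀ i ∈ S.erase e, ∀ j x, x ∈ ZZ r B (y e) (LL y c) j →
      y i x ∈ ZZ r B (y e) (LL y c) (j + 1) :=
    fun i hi j x hx => ZZ_z hp (had i hi) (hA.comm i e) hx
  have hBs : ∀ i ∈ S.erase e, ∀ k x, x ∈ BB β r B (y e) (LL y c) k →
      y i x ∈ BB β r B (y e) (LL y c) (k + 1) :=
    fun i hi => BB_stab hp (had i hi).op (hZs i hi)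
  refine ⟨BB β r B (y e) (LL y c), ⟨hBs, ?_, ?_, ?_⟩, ⟨ho, ?_⟩, (BB_le 0).trans hB0⟩
  · intro k hk x hx
    exact hG.top k hk x hx.1
  · intro k hk x hx hp'
    exact BB_nondeg hp hk hx hp'
  · intro c' hc' hc0' k hk x hx h0 hne
    have hp' := hG.pre hA he hc' hc0'
    have oZ := LL_op hA c' hc0' hZs
    have oB := LL_op hA c' hc0' hBs
    have hK := delete_K hA hG he hc hc0 hc' hc0'
    refine lt_of_le_of_ne (lemE hp' hk hx.1 h0) (fun heq => hne ?_)
    obtain ⟨g, u, hgu, hu, hg0, hg⟩ := lemF hp' hk hx.1 h0 (by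
      have hs : ((-1 : ℝ)) ^ k ≠ 0 := by simp
      simpa [hs] using heq.symm)
    apply hK k hk x hx
    have h1 : (LL y c' ^ (r - 2 * k)) x = (LL y c' ^ (r - 2 * k + 1)) g := by
      rw [hgu, map_add, T0_pow_zero hu le_rfl, add_zero, pow_app_succ]
    rcases k with _ | j
    · rw [h1, hg0 rfl, map_zero]
    · have hgT := hg j rfl
      obtain ⟨w, hw, b, hb, hab⟩ := BB_decomp hp (k := j) (by omega) (mem_T0.1 hgT).1
      have hb0 : b = 0 := by
        apply hK j (by omega) b hb
        apply BB_inf hp (k := r - j) (by omega) (oB.pow_stab _ j _ (by omega) b hb)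
        have : (LL y c' ^ (r - 2 * j)) b = - (LL y c' ^ (r - 2 * j)) w := by
          have := (mem_T0.1 hgT).2
          rw [hab, map_add] at this
          exact eq_neg_of_add_eq_zero_right this
        rw [this]
        exact Submodule.neg_mem _ (oZ.pow_stab _ j _ (by omega) w hw)
      rw [hb0, add_zero] at hab
      apply BB_inf hp (k := r - (j + 1)) (by omega)
      · exact oB.pow_stab _ (j + 1) _ (by omega) x hx
      · rw [h1, hab]
        exact oZ.pow_stab _ j _ (by omega) w hw
  · have hT00 : ∀ a ∈ T0 r B (LL y c) 0, a = 0 := by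
      intro a ha
      obtain ⟨ha1, ha2⟩ := mem_T0.1 ha
      obtain ⟨l, rfl⟩ := Submodule.mem_span_singleton.1 (hB0 ha1)
      rw [map_smul, smul_eq_zero] at ha2
      rcases ha2 with h | h
      · rw [h, zero_smul]
      · exact absurd h hor
    have hT : ∀ j, r ≤ j + 1 → ∀ a ∈ TT r B (LL y c) j, a = 0 := by
      intro j hj x hx
      obtain ⟨a, ha, rfl⟩ := TT_decomp _ _ hx
      apply Finset.sum_eq_zero
      intro k hk
      have := Finset.mem_range.1 hk
      rcases k with _ | k
      · rw [hT00 _ (ha 0), map_zero]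
      · exact T0_pow_zero (ha _) (by omega)
    intro w hw
    have : w = 0 := by
      rw [Nat.sub_zero] at hw
      rcases r with _ | r
      · exact hT 0 (by omega) w hw
      · obtain ⟨u, hu, _, ⟨t, ht, rfl⟩, rfl⟩ := Submodule.mem_sup.1 hw
        rw [hT _ (by omega) u hu, hT _ le_rfl t ht, map_zero, add_zero]
    rw [this]; simp

end fin
end TopHeavy

namespace TopHeavy
set_option linter.unusedSectionVars false

section deformation
variable {E : Type*} [NormedAddCommGroup E] [NormedSpace ℝ E] [FiniteDimensional ℝ E]
variable {β : E →ₗ[ℝ] E →ₗ[ℝ] ℝ} {r : ℕ} {B : ℕ → Submodule ℝ E} {P Q N : Module.End ℝ E}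

theorem cont_pow (P Q : Module.End ℝ E) (m : ℕ) :
    Continuous (fun p : ℝ × E => ((P + p.1 • Q) ^ m) p.2) := by
  induction m with
  | zero => simpa using continuous_snd
  | succ m ih =>
    have : (fun p : ℝ × E => ((P + p.1 • Q) ^ (m + 1)) p.2) = fun p =>
        P (((P + p.1 • Q) ^ m) p.2) + p.1 • Q (((P + p.1 • Q) ^ m) p.2) := by
      funext p
      rw [← app_pow_succ]
      simp
    rw [this]
    exact ((LinearMap.continuous_of_finiteDimensional P).comp ih).add
      (continuous_fst.smul ((LinearMap.continuous_of_finiteDimensional Q).comp ih))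

theorem radical_zero (hS : Sys β r B) (hN : Op β B N)
    (hHL : ∀ k, 2 * k < r → ∀ x ∈ B k, (N ^ (r - 2 * k)) x = 0 → x = 0) {k : ℕ} (hk : 2 * k ≤ r)
    {x : E} (hx : x ∈ B k) (h0 : (N ^ (r - 2 * k + 1)) x = 0)
    (hp : ∀ x' ∈ B k, (N ^ (r - 2 * k + 1)) x' = 0 → β x' ((N ^ (r - 2 * k)) x) = 0) : x = 0 := by
  obtain ⟨g, hg1, hg2, hg3⟩ := lemD' hS hN hk (x := (N ^ (r - 2 * k)) x)
    (hN.pow_stab _ _ _ (by omega) _ hx) hp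
  have hg : g = 0 := by
    rcases k with _ | j
    · exact hg2 rfl
    · apply hHL j (by omega) g (hg3 j rfl)
      rw [show r - 2 * j = r - 2 * (j + 1) + 1 + 1 by omega, ← app_pow_succ, hg1, app_pow_succ, h0]
  rw [hg, map_zero] at hg1
  by_cases hk' : 2 * k < r
  · exact hHL k hk' x hx hg1.symm
  · rw [show r - 2 * k = 0 by omega] at hg1
    simpa using hg1.symm

theorem deform_HR (hS : Sys β r B) (hP : Op β B P) (hQ : Op β B Q)
    (hHL : ∀ s ∈ Set.Icc (0 : ℝ) 1, ∀ k, 2 * k < r → ∀ x ∈ B k,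
      ((P + s • Q) ^ (r - 2 * k)) x = 0 → x = 0)
    (h0 : HR β r B P) : HR β r B (P + Q) := by
  intro k hk
  set d := r - 2 * k with hd
  have hop : ∀ s : ℝ, Op β B (P + s • Q) := fun s => hP.add (hQ.smul s)
  let G : Set ℝ := {s | ∀ x ∈ B k, ((P + s • Q) ^ (d + 1)) x = 0 → x ≠ 0 →
    0 < (-1) ^ k * β x (((P + s • Q) ^ d) x)}
  have hsurj : ∀ s ∈ Set.Icc (0 : ℝ) 1, ∀ x ∈ B (r - k + 1),
      ∃ x' ∈ B k, ((P + s • Q) ^ (d + 1)) x' = x := by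
    intro s hs x hx
    apply lemSurj' hS (hop s) hk _ hx
    intro j hj p hp h0
    exact hHL s hs j (by omega) p hp (pow_zero_of_le (by omega) h0)
  have hcl : IsClosed (G ∩ Set.Icc 0 1) := by
    apply isClosed_of_closure_subset
    intro s₀ hs₀
    have hI : s₀ ∈ Set.Icc (0 : ℝ) 1 :=
      isClosed_Icc.closure_subset (closure_mono Set.inter_subset_right hs₀)
    refine ⟨?_, hI⟩
    -- semidefiniteness by approximation
    have hsemi : ∀ x ∈ B k, ((P + s₀ • Q) ^ (d + 1)) x = 0 →
        0 ≤ (-1) ^ k * β x (((P + s₀ • Q) ^ d) x) := by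
      intro x hx hx0
      let f : ℝ → B k →ₗ[ℝ] B (r - k + 1) := fun s =>
        ((P + s • Q) ^ (d + 1)).restrict (fun x hx => (hop s).pow_stab _ _ _ (by omega) x hx)
      have hfc : ∀ p, ContinuousAt (fun s => f s p) s₀ := by
        intro p
        rw [Topology.IsInducing.subtypeVal.continuousAt_iff]
        have := (cont_pow P Q (d + 1)).comp (Continuous.prodMk continuous_id
          (continuous_const (y := (p : E))))
        exact this.continuousAt
      obtain ⟨e, he1, he2⟩ := right_inv_family f s₀ hfc (by
        rintro ⟨x, hx⟩
        obtain ⟨x', hx', h'⟩ := hsurj s₀ hI x hx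
        exact ⟨⟨x', hx'⟩, Subtype.ext h'⟩)
      let xs : ℝ → B k := fun s => ⟨x, hx⟩ - e s (f s ⟨x, hx⟩)
      have hxs : ContinuousAt xs s₀ := continuousAt_const.sub (he1 _ (hfc _))
      have hf0 : f s₀ ⟨x, hx⟩ = 0 := Subtype.ext hx0
      have hxs0 : (xs s₀ : E) = x := by simp [xs, hf0]
      have hxsE : ContinuousAt (fun s => (xs s : E)) s₀ :=
        continuous_subtype_val.continuousAt.comp hxs
      have hlim : ContinuousAt (fun s => (-1) ^ k * β (xs s) (((P + s • Q) ^ d) (xs s))) s₀ := by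
        refine continuousAt_const.mul (cont_bilin_at β hxsE ?_)
        have := (cont_pow P Q d).continuousAt.comp (x := s₀)
          (ContinuousAt.prodMk continuousAt_id hxsE)
        exact this
      have hfreq : ∃ᶠ s in nhds s₀, 0 ≤ (-1) ^ k * β (xs s) (((P + s • Q) ^ d) (xs s)) := by
        have hfr := mem_closure_iff_frequently.1 hs₀
        refine (hfr.and_eventually he2).mono ?_
        rintro s ⟨⟨hsG, -⟩, hs⟩
        by_cases hne : (xs s : E) = 0
        · simp [hne]
        · refine (hsG (xs s) (xs s).2 ?_ hne).le
          have h1 : f s (xs s) = 0 := by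
            simp only [xs, map_sub, hs, sub_self]
          exact congrArg Subtype.val h1
      have := ge_of_tendsto_of_frequently hlim hfreq
      simpa [hxs0] using this
    intro x hx hx0 hne
    refine lt_of_le_of_ne (hsemi x hx hx0) (fun heq => hne ?_)
    apply radical_zero hS (hop s₀) (hHL s₀ hI) hk hx hx0
    intro x' hx' hx'0
    rw [← hd] at hx'0 ⊢
    have hs : ((-1 : ℝ)) ^ k ≠ 0 := by simp
    have hn : β x (((P + s₀ • Q) ^ d) x) = 0 := by simpa [hs] using heq.symm
    have key : ∀ l : ℝ, 0 ≤ l * ((-1) ^ k * (2 * β x' (((P + s₀ • Q) ^ d) x))) +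
        l ^ 2 * ((-1) ^ k * β x' (((P + s₀ • Q) ^ d) x')) := by
      intro l
      have := hsemi (x + l • x') ((B k).add_mem hx ((B k).smul_mem _ hx')) (by
        rw [map_add, map_smul, hx0, hx'0]; simp)
      simp only [map_add, map_smul, LinearMap.add_apply (β x), LinearMap.add_apply, 
        LinearMap.smul_apply, hn, smul_eq_mul] at this
      have e : β x (((P + s₀ • Q) ^ d) x') = β x' (((P + s₀ • Q) ^ d) x) := by
        rw [← (hop s₀).pow_adj, hS.symm]
      rw [e] at this
      linarith
    have := quad_zero key
    simpa [hs] using this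
  have hopen : ∀ s ∈ G ∩ Set.Ico (0 : ℝ) 1, G ∈ nhdsWithin s (Set.Ioi s) := by
    rintro s ⟨hsG, hs⟩
    let C : Set (ℝ × E) := {p | p.1 ∈ Set.Icc (0 : ℝ) 1 ∧ p.2 ∈ Metric.sphere (0 : E) 1 ∧
      p.2 ∈ B k ∧ ((P + p.1 • Q) ^ (d + 1)) p.2 = 0 ∧
      (-1) ^ k * β p.2 (((P + p.1 • Q) ^ d) p.2) ≤ 0}
    have hC : IsCompact C := by
      refine (isCompact_Icc.prod (isCompact_sphere (0 : E) 1)).of_isClosed_subset ?_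
        (fun p hp => ⟨hp.1, hp.2.1⟩) 
      have c1 : IsClosed {p : ℝ × E | p.1 ∈ Set.Icc (0 : ℝ) 1} := isClosed_Icc.preimage continuous_fst
      have c2 : IsClosed {p : ℝ × E | p.2 ∈ Metric.sphere (0 : E) 1} :=
        Metric.isClosed_sphere.preimage continuous_snd
      have c3 : IsClosed {p : ℝ × E | p.2 ∈ B k} :=
        (Submodule.closed_of_finiteDimensional (B k)).preimage continuous_snd
      have c4 : IsClosed {p : ℝ × E | ((P + p.1 • Q) ^ (d + 1)) p.2 = 0} :=
        isClosed_eq (cont_pow P Q (d + 1)) continuous_const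
      have c5 : IsClosed {p : ℝ × E | (-1) ^ k * β p.2 (((P + p.1 • Q) ^ d) p.2) ≤ 0} :=
        isClosed_le (continuous_const.mul ((continuous_bilin β).comp
          (continuous_snd.prodMk (cont_pow P Q d)))) continuous_const
      exact c1.inter (c2.inter (c3.inter (c4.inter c5)))
    have hbad : IsClosed (Prod.fst '' C) := (hC.image continuous_fst).isClosed
    have hsb : s ∉ Prod.fst '' C := by
      rintro ⟨⟨s', x⟩, ⟨-, h2, h3, h4, h5⟩, rfl⟩
      have hx : x ≠ 0 := by
        rintro rfl
        simp at h2
      exact absurd (hsG x h3 h4 hx) (not_lt.2 h5)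
    have h1 : ∀ᶠ t in nhdsWithin s (Set.Ioi s), t ∉ Prod.fst '' C :=
      nhdsWithin_le_nhds (hbad.isOpen_compl.mem_nhds hsb)
    have h2 : ∀ᶠ t in nhdsWithin s (Set.Ioi s), t < 1 :=
      nhdsWithin_le_nhds (gt_mem_nhds hs.2)
    filter_upwards [h1, h2, self_mem_nhdsWithin] with t ht1 ht2 ht3
    intro x hx hx0 hne
    by_contra hcon
    push Not at hcon
    have hnx : ‖x‖ ≠ 0 := norm_ne_zero_iff.2 hne
    refine ht1 ⟨(t, ‖x‖⁻¹ • x), ⟨⟨hs.1.trans (le_of_lt ht3), ht2.le⟩, ?_, (B k).smul_mem _ hx, ?_, ?_⟩,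
      rfl⟩
    · simp [norm_smul, hnx]
    · simp only [map_smul, hx0, smul_zero]
    · simp only [map_smul, LinearMap.smul_apply, smul_eq_mul]
      have : (0 : ℝ) ≤ ‖x‖⁻¹ := by positivity
      have h3 := mul_nonneg this this
      nlinarith
  have hsub : Set.Icc (0 : ℝ) 1 ⊆ G := hcl.Icc_subset_of_forall_mem_nhdsWithin (by
    intro x hx hx0 hne
    have := h0 k hk x hx (by simpa using hx0) hne
    simpa using this) hopen
  have := hsub (Set.right_mem_Icc.2 zero_le_one)
  simpa [G] using this

end deformation
end TopHeavy

namespace TopHeavy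
set_option linter.unusedSectionVars false

open Module

section concrete
variable (F : Type) [Field F] (V : Type) [AddCommGroup V] [Module F V] [Finite V]

noncomputable instance fintypeSub : Fintype (Submodule F V) := by
  haveI : Finite (Submodule F V) := Finite.of_injective (fun W => (W : Set V)) SetLike.coe_injective
  exact Fintype.ofFinite _

/-- The space of functions on the lattice of subspaces. -/
abbrev AV := Submodule F V → ℝ

variable {F V}

open Classical in
/-- indicator function -/
noncomputable def del (W : Submodule F V) : AV F V := Pi.single W 1

open Classical in
theorem del_apply (W W' : Submodule F V) : del W W' = if W' = W then 1 else 0 := by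
  simp [del, Pi.single_apply]

theorem sum_del (f : AV F V) : f = ∑ W, f W • del W := by
  funext W'
  simp [del_apply]

theorem ext_del {M : Type*} [AddCommMonoid M] [Module ℝ M] {f g : AV F V →ₗ[ℝ] M}
    (h : ∀ W, f (del W) = g (del W)) : f = g := by
  apply LinearMap.ext
  intro x
  rw [sum_del x]
  simp [h]

open Classical in
/-- linear extension from indicator functions -/
noncomputable def lin {M : Type*} [AddCommMonoid M] [Module ℝ M] (φ : Submodule F V → M) :
    AV F V →ₗ[ℝ] M := ∑ W, (LinearMap.proj W : AV F V →ₗ[ℝ] ℝ).smulRight (φ W)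

theorem lin_del {M : Type*} [AddCommMonoid M] [Module ℝ M] (φ : Submodule F V → M)
    (W : Submodule F V) : lin φ (del W) = φ W := by
  simp [lin, del_apply]

open Classical in
/-- multiplication by the atom `v` -/
noncomputable def yy (v : V) : Module.End ℝ (AV F V) :=
  lin (fun W => if v ∈ W then 0 else del (W ⊔ F ∙ v))

open Classical in
theorem yy_del (v : V) (W : Submodule F V) :
    yy v (del W) = if v ∈ W then 0 else del (W ⊔ F ∙ v) := lin_del _ W

open Classical in
/-- the pairing -/
noncomputable def bb : AV F V →ₗ[ℝ] AV F V →ₗ[ℝ] ℝ :=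
  lin (fun W => lin (fun W' => if IsCompl W W' then 1 else 0))

open Classical in
theorem bb_del (W W' : Submodule F V) :
    bb (del W) (del W') = if IsCompl W W' then (1 : ℝ) else 0 := by
  simp [bb, lin_del]

theorem mem_sup_span_exchange {W : Submodule F V} {v w : V} (h : w ∈ W ⊔ F ∙ v) (hw : w ∉ W) :
    v ∈ W ⊔ F ∙ w := by
  have h1 : ∀ u : V, W ⊔ F ∙ u = Submodule.span F (insert u (W : Set V)) := by
    intro u
    rw [Submodule.span_insert, Submodule.span_eq, sup_comm]
  rw [h1] at h ⊢
  exact mem_span_insert_exchange h (by simpa using hw)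

theorem disj_span {W : Submodule F V} {v : V} (h : v ∉ W) : Disjoint W (F ∙ v) := by
  rw [Submodule.disjoint_span_singleton']
  · exact h
  · rintro rfl; exact h W.zero_mem

theorem not_mem_of_disj {W : Submodule F V} {v : V} (h : Disjoint W (F ∙ v)) (hv : v ≠ 0) :
    v ∉ W := by
  rwa [Submodule.disjoint_span_singleton' hv] at h

theorem isCompl_move {W Y : Submodule F V} {v : V} (hv : v ∉ W) (h : IsCompl (W ⊔ F ∙ v) Y) :
    v ∉ Y ∧ IsCompl W (Y ⊔ F ∙ v) := by
  have hv0 : v ≠ 0 := by rintro rfl; exact hv W.zero_mem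
  have hd := h.disjoint
  refine ⟨?_, ?_, ?_⟩
  · apply not_mem_of_disj _ hv0
    exact (hd.mono_left le_sup_right).symm
  · have := (disj_span hv).disjoint_sup_right_of_disjoint_sup_left hd
    rwa [sup_comm] at this
  · have := h.codisjoint
    rw [codisjoint_iff] at this ⊢
    rw [← this]
    ac_rfl

theorem alg_yy : Alg (bb (F := F) (V := V)) (yy (F := F)) := by
  classical
  refine ⟨?_, ?_, ?_, ?_⟩
  · intro a b
    have : bb (F := F) (V := V) = bb.flip := by
      apply ext_del; intro W
      apply ext_del; intro W'
      rw [LinearMap.flip_apply, bb_del, bb_del]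
      exact if_congr isCompl_comm rfl rfl
    conv_lhs => rw [this]
    rfl
  · intro v w
    apply ext_del
    intro W
    simp only [Module.End.mul_apply, yy_del]
    by_cases hv : v ∈ W <;> by_cases hw : w ∈ W
    · simp [hv, hw]
    · have : v ∈ W ⊔ F ∙ w := Submodule.mem_sup_left hv
      simp [hv, hw, yy_del, this]
    · have : w ∈ W ⊔ F ∙ v := Submodule.mem_sup_left hw
      simp [hv, hw, yy_del, this]
    · have : v ∈ W ⊔ F ∙ w ↔ w ∈ W ⊔ F ∙ v :=
        ⟨fun h => mem_sup_span_exchange h hv, fun h => mem_sup_span_exchange h hw⟩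
      simp only [hv, hw, if_false, yy_del]
      rw [sup_right_comm]
      exact if_congr this rfl rfl
  · intro v
    apply ext_del
    intro W
    simp only [Module.End.mul_apply, yy_del]
    by_cases hv : v ∈ W
    · simp [hv]
    · have : v ∈ W ⊔ F ∙ v := Submodule.mem_sup_right (Submodule.mem_span_singleton_self v)
      simp [hv, yy_del, this]
  · intro v a b
    have : bb (F := F) ∘ₗ yy v = bb.compl₂ (yy v) := by
      apply ext_del; intro W
      apply ext_del; intro Y
      simp only [LinearMap.comp_apply, LinearMap.compl₂_apply, yy_del]
      by_cases hv : v ∈ W <;> by_cases hy : v ∈ Y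
      · simp [hv, hy]
      · have : ¬ IsCompl W (Y ⊔ F ∙ v) := fun h => (isCompl_move hy h.symm).1 hv
        simp [hv, hy, bb_del, this]
      · have : ¬ IsCompl (W ⊔ F ∙ v) Y := fun h => (isCompl_move hv h).1 hy
        simp [hv, hy, bb_del, this]
      · have : IsCompl (W ⊔ F ∙ v) Y ↔ IsCompl W (Y ⊔ F ∙ v) :=
          ⟨fun h => (isCompl_move hv h).2, fun h => (isCompl_move hy h.symm).2.symm⟩
        simp only [hv, hy, if_false, bb_del]
        exact if_congr this rfl rfl
    exact LinearMap.congr_fun (LinearMap.congr_fun this a) b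

/-- functions supported on subspaces of dimension `k` -/
def gr (k : ℕ) : Submodule ℝ (AV F V) where
  carrier := {f | ∀ W : Submodule F V, finrank F W ≠ k → f W = 0}
  add_mem' := by
    intro a b ha hb W hW
    simp [ha W hW, hb W hW]
  zero_mem' := fun W _ => rfl
  smul_mem' := by
    intro c a ha W hW
    simp [ha W hW]

theorem del_mem (W : Submodule F V) {k : ℕ} (h : finrank F W = k) : del W ∈ gr (F := F) (V := V) k := by
  intro W' hW'
  have : W' ≠ W := by rintro rfl; exact hW' h
  simp [del_apply, this]

theorem gr_induct {k : ℕ} {M : Type*} [AddCommMonoid M] [Module ℝ M] (φ : AV F V →ₗ[ℝ] M)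
    (C : Submodule ℝ M) (h : ∀ W : Submodule F V, finrank F W = k → φ (del W) ∈ C) (f : AV F V) (hf : f ∈ gr k) :
    φ f ∈ C := by
  rw [sum_del f, map_sum]
  apply C.sum_mem
  intro W _
  rw [map_smul]
  by_cases hW : finrank F W = k
  · exact C.smul_mem _ (h W hW)
  · rw [hf W hW, zero_smul]; exact C.zero_mem

theorem finrank_sup_span {W : Submodule F V} {v : V} (hv : v ∉ W) :
    finrank F (W ⊔ F ∙ v : Submodule F V) = finrank F W + 1 := by
  have hv0 : v ≠ 0 := by rintro rfl; exact hv W.zero_mem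
  have := Submodule.finrank_sup_add_finrank_inf_eq W (F ∙ v)
  rw [(disj_span hv).eq_bot, finrank_bot, finrank_span_singleton hv0] at this
  simpa using this

theorem yy_stab (v : V) (k : ℕ) (f : AV F V) (hf : f ∈ gr k) : yy v f ∈ gr (F := F) (k + 1) := by
  apply gr_induct (yy v) _ _ f hf
  intro W hW
  rw [yy_del]
  split_ifs with h
  · exact Submodule.zero_mem _
  · exact del_mem _ (by rw [finrank_sup_span h, hW])

theorem isCompl_iff_disjoint {W Y : Submodule F V} (h : finrank F W + finrank F Y = finrank F V) :
    IsCompl W Y ↔ Disjoint W Y := by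
  refine ⟨fun h => h.disjoint, fun hd => ⟨hd, ?_⟩⟩
  rw [codisjoint_iff]
  apply Submodule.eq_top_of_finrank_eq
  have := Submodule.finrank_sup_add_finrank_inf_eq W Y
  rw [hd.eq_bot, finrank_bot] at this
  omega

theorem move_iff {W Y : Submodule F V} {v : V} :
    (v ∉ Y ∧ Disjoint W (Y ⊔ F ∙ v)) ↔ (Disjoint W Y ∧ v ∉ W ⊔ Y) := by
  constructor
  · rintro ⟨hv, hd⟩
    have hv0 : v ≠ 0 := by rintro rfl; exact hv Y.zero_mem
    refine ⟨hd.mono_right le_sup_left, not_mem_of_disj ?_ hv0⟩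
    exact (disj_span hv).disjoint_sup_left_of_disjoint_sup_right hd
  · rintro ⟨hd, hv⟩
    exact ⟨fun h => hv (Submodule.mem_sup_right h),
      hd.disjoint_sup_right_of_disjoint_sup_left (disj_span hv)⟩

end concrete
end TopHeavy

namespace TopHeavy
set_option linter.unusedSectionVars false

open Module

section concrete
variable {F : Type} [Field F] {V : Type} [AddCommGroup V] [Module F V] [Finite V]

open Classical in
theorem exists_mu : ∃ μ : Submodule F V → ℝ,
    ∀ Y, ∑ Z, (if Z ≤ Y then μ Z else 0) = if Y = ⊥ then 1 else 0 := by
  let : LocallyFiniteOrder (Submodule F V) := Fintype.toLocallyFiniteOrder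
  refine ⟨fun Z => IncidenceAlgebra.mu ℝ ⊥ Z, fun Y => ?_⟩
  have := IncidenceAlgebra.sum_Icc_mu_right (𝕜 := ℝ) (⊥ : Submodule F V) Y
  rw [← Finset.sum_filter]
  rw [show (Finset.univ.filter fun Z => Z ≤ Y) = Finset.Icc ⊥ Y by ext; simp, this]
  exact if_congr eq_comm rfl rfl

open Classical in
theorem weisner (μ : Submodule F V → ℝ)
    (hμ : ∀ Y, ∑ Z, (if Z ≤ Y then μ Z else 0) = if Y = ⊥ then 1 else 0) (p : V) (hp : p ≠ 0)
    (Y : Submodule F V) (hY : p ∈ Y) : ∑ Z, (if Z ⊔ F ∙ p = Y then μ Z else 0) = 0 := by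
  induction Y using WellFoundedLT.induction with
  | _ Y ih =>
  have hYb : Y ≠ ⊥ := by rintro rfl; exact hp (by simpa using hY)
  have h1 := hμ Y
  rw [if_neg hYb] at h1
  have h2 : ∀ Z, (if Z ≤ Y then μ Z else 0) =
      ∑ X, if X ≤ Y then (if Z ⊔ F ∙ p = X then μ Z else 0) else 0 := by
    intro Z
    rw [Finset.sum_eq_single (Z ⊔ F ∙ p)]
    · have : Z ⊔ F ∙ p ≤ Y ↔ Z ≤ Y := by simp [hY]
      simp only [if_true]
      exact if_congr this.symm rfl rfl
    · intro X _ hX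
      simp [hX.symm]
    · simp
  simp_rw [h2] at h1
  rw [Finset.sum_comm, Finset.sum_eq_single Y] at h1
  · simpa using h1
  · intro X _ hX
    by_cases hXY : X ≤ Y
    · simp only [hXY, if_true]
      by_cases hpX : p ∈ X
      · exact ih X (lt_of_le_of_ne hXY hX) hpX
      · apply Finset.sum_eq_zero
        intro Z _
        rw [if_neg]
        rintro rfl
        exact hpX (Submodule.mem_sup_right (Submodule.mem_span_singleton_self p))
    · simp [hXY]
  · simp

open Classical in
theorem mu_sign (μ : Submodule F V → ℝ)
    (hμ : ∀ Y, ∑ Z, (if Z ≤ Y then μ Z else 0) = if Y = ⊥ then 1 else 0) (n : ℕ)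
    (Y : Submodule F V) (hn : finrank F Y = n) : 0 < (-1) ^ n * μ Y := by
  induction n generalizing Y with
  | zero =>
    obtain rfl : Y = ⊥ := Submodule.finrank_eq_zero.1 hn
    have := hμ ⊥
    simp only [le_bot_iff, if_true, Finset.sum_ite_eq', Finset.mem_univ] at this
    rw [this]; norm_num
  | succ n ih =>
    have hYb : Y ≠ ⊥ := by rintro rfl; simp at hn
    obtain ⟨p, hpY, hp⟩ := Submodule.exists_mem_ne_zero_of_ne_bot hYb
    have h1 := weisner μ hμ p hp Y hpY
    have hpY' : Y ⊔ F ∙ p = Y := by simpa using hpY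
    rw [← Finset.add_sum_erase _ _ (Finset.mem_univ Y), if_pos hpY'] at h1
    have hZ : ∀ Z, Z ≠ Y → Z ⊔ F ∙ p = Y → finrank F Z = n := by
      intro Z hne h
      have hpZ : p ∉ Z := by
        intro hpZ
        apply hne
        rw [← h]
        simpa using hpZ
      have := finrank_sup_span hpZ
      rw [h, hn] at this
      omega
    have h2 : 0 < ∑ Z ∈ Finset.univ.erase Y, (if Z ⊔ F ∙ p = Y then (-1) ^ n * μ Z else 0) := by
      apply Finset.sum_pos'
      · intro Z hZe
        split_ifs with h
        · exact (ih Z (hZ Z (Finset.ne_of_mem_erase hZe) h)).le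
        · exact le_rfl
      · obtain ⟨Z0, hZ0⟩ := exists_isCompl (F ∙ p)
        have hne : Z0 ⊓ Y ≠ Y := by
          intro h
          have hpZ0 : p ∈ Z0 := by
            have : p ∈ Z0 ⊓ Y := by rw [h]; exact hpY
            exact this.1
          exact not_mem_of_disj hZ0.disjoint.symm hp hpZ0
        have hsup : (Z0 ⊓ Y) ⊔ F ∙ p = Y := by
          rw [sup_comm, ← sup_inf_assoc_of_le Z0 (by simpa using hpY), hZ0.sup_eq_top, top_inf_eq]
        refine ⟨Z0 ⊓ Y, by simp [hne], ?_⟩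
        rw [if_pos hsup]
        exact ih _ (hZ _ hne hsup)
    have h3 : ∑ Z ∈ Finset.univ.erase Y, (if Z ⊔ F ∙ p = Y then (-1) ^ n * μ Z else 0) =
        (-1) ^ n * ∑ Z ∈ Finset.univ.erase Y, (if Z ⊔ F ∙ p = Y then μ Z else 0) := by
      rw [Finset.mul_sum]
      apply Finset.sum_congr rfl
      intro Z _
      split_ifs <;> simp
    rw [h3] at h2
    rw [pow_succ]
    linear_combination h2 + (-1) ^ n * h1

open Classical in
/-- sum over subspaces disjoint from `X` -/
noncomputable def hh (f : AV F V) (X : Submodule F V) : ℝ := ∑ W, if Disjoint W X then f W else 0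

open Classical in
/-- sum over subspaces containing `X` -/
noncomputable def FF (f : AV F V) (X : Submodule F V) : ℝ := ∑ W, if X ≤ W then f W else 0

open Classical in
theorem hh_eq (μ : Submodule F V → ℝ)
    (hμ : ∀ Y, ∑ Z, (if Z ≤ Y then μ Z else 0) = if Y = ⊥ then 1 else 0) (f : AV F V)
    (X : Submodule F V) : hh f X = ∑ Z, if Z ≤ X then μ Z * FF f Z else 0 := by
  have h1 : ∀ W, (if Disjoint W X then f W else 0) =
      ∑ Z, f W * (if Z ≤ W ⊓ X then μ Z else 0) := by
    intro W
    rw [← Finset.mul_sum, hμ, mul_ite, mul_one, mul_zero]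
    exact if_congr disjoint_iff rfl rfl
  simp only [hh]
  simp_rw [h1]
  rw [Finset.sum_comm]
  apply Finset.sum_congr rfl
  intro Z _
  simp only [FF, le_inf_iff]
  by_cases hZ : Z ≤ X
  · simp only [hZ, and_true, if_true]
    rw [Finset.mul_sum]
    apply Finset.sum_congr rfl
    intro W _
    split_ifs <;> ring
  · simp [hZ]

theorem FF_zero (μ : Submodule F V → ℝ) (hμ0 : ∀ Y, μ Y ≠ 0) (f : AV F V)
    (hh' : ∀ X, hh f X = ∑ Z, open Classical in if Z ≤ X then μ Z * FF f Z else 0) (m : ℕ)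
    (hm : ∀ X : Submodule F V, finrank F X < m → hh f X = 0) (X : Submodule F V)
    (hX : finrank F X < m) : FF f X = 0 := by
  classical
  induction X using WellFoundedLT.induction with
  | _ X ih =>
  have h1 := hm X hX
  rw [hh', Finset.sum_eq_single X] at h1
  · rw [if_pos le_rfl] at h1
    exact (mul_eq_zero.1 h1).resolve_left (hμ0 X)
  · intro Z _ hZ
    by_cases hZX : Z ≤ X
    · rw [if_pos hZX, ih Z (lt_of_le_of_ne hZX hZ)
        (lt_of_le_of_lt (Submodule.finrank_mono hZX) hX), mul_zero]
    · rw [if_neg hZX]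
  · simp

theorem FF_eq {k : ℕ} {f : AV F V} (hf : f ∈ gr k) (X : Submodule F V) (hX : finrank F X = k) :
    FF f X = f X := by
  classical
  rw [FF, Finset.sum_eq_single X]
  · simp
  · intro W _ hW
    split_ifs with h
    · apply hf
      intro hWk
      exact hW (Submodule.eq_of_le_of_finrank_eq h (by omega)).symm
    · rfl
  · simp

theorem FF_big {k : ℕ} {f : AV F V} (hf : f ∈ gr k) (X : Submodule F V) (hX : k < finrank F X) :
    FF f X = 0 := by
  classical
  apply Finset.sum_eq_zero
  intro W _
  split_ifs with h
  · apply hf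
    have := Submodule.finrank_mono h
    omega
  · rfl

section
variable [Fintype V] [DecidableEq V]

/-- the all-ones operator -/
noncomputable abbrev N1 : Module.End ℝ (AV F V) := LL (yy (F := F)) (fun _ : V => (1 : ℝ))

theorem kappa (m : ℕ) : ∃ κ : ℝ, 0 < κ ∧ ∀ W Y : Submodule F V,
    finrank F W + finrank F Y + m = finrank F V →
    bb (del W) ((N1 ^ m) (del Y)) = open Classical in if Disjoint W Y then κ else 0 := by
  classical
  induction m with
  | zero =>
    refine ⟨1, one_pos, fun W Y h => ?_⟩
    rw [pow_zero, Module.End.one_apply, bb_del]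
    exact if_congr (isCompl_iff_disjoint (by omega)) rfl rfl
  | succ m ih =>
    obtain ⟨κ, hκ, h⟩ := ih
    have key : ∀ W Y : Submodule F V, finrank F W + finrank F Y + (m + 1) = finrank F V →
        bb (del W) ((N1 ^ (m + 1)) (del Y)) = if Disjoint W Y then
          κ * ((Fintype.card V : ℝ) - (Nat.card (W ⊔ Y : Submodule F V) : ℝ)) else 0 := by
      intro W Y hd
      rw [← pow_app_succ]
      have h1 : N1 (del Y) = ∑ v : V, yy (F := F) v (del Y) := by simp [LL]
      rw [h1, map_sum, map_sum]
      have h2 : ∀ v : V, bb (del W) ((N1 ^ m) (yy v (del Y))) =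
          if (Disjoint W Y ∧ v ∉ W ⊔ Y) then κ else 0 := by
        intro v
        rw [yy_del]
        by_cases hv : v ∈ Y
        · have : v ∈ W ⊔ Y := Submodule.mem_sup_right hv
          simp [hv, this]
        · rw [if_neg hv, h W _ (by rw [finrank_sup_span hv]; omega)]
          apply if_congr _ rfl rfl
          rw [← move_iff]
          simp [hv]
      simp_rw [h2]
      by_cases hWY : Disjoint W Y
      · simp only [hWY, true_and, if_true]
        rw [← Finset.sum_filter, Finset.sum_const, nsmul_eq_mul, mul_comm]
        congr 1
        have h3 := Finset.card_filter_add_card_filter_not (s := (Finset.univ : Finset V)) (fun v => v ∈ W ⊔ Y)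
        have h4 : Nat.card (W ⊔ Y : Submodule F V) =
            (Finset.univ.filter (fun v => v ∈ W ⊔ Y)).card := by
          rw [Nat.card_eq_fintype_card, Fintype.card_subtype]
        rw [h4, eq_sub_iff_add_eq, ← Finset.card_univ, ← h3]
        push_cast; ring
      · simp [hWY]
    by_cases hex : ∃ W₀ Y₀ : Submodule F V, Disjoint W₀ Y₀ ∧
        finrank F W₀ + finrank F Y₀ + (m + 1) = finrank F V
    swap
    · refine ⟨1, one_pos, fun W Y hd => ?_⟩
      rw [key W Y hd]
      have : ¬ Disjoint W Y := fun h => hex ⟨W, Y, h, hd⟩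
      simp [this]
    obtain ⟨W₀, Y₀, hd₀, hf₀⟩ := hex
    have hfr : ∀ W Y : Submodule F V, Disjoint W Y → 
        finrank F (W ⊔ Y : Submodule F V) = finrank F W + finrank F Y := by
      intro W Y hd
      have := Submodule.finrank_sup_add_finrank_inf_eq W Y
      rwa [hd.eq_bot, finrank_bot, add_zero] at this
    refine ⟨κ * ((Fintype.card V : ℝ) - (Nat.card (W₀ ⊔ Y₀ : Submodule F V) : ℝ)), ?_, ?_⟩
    · apply mul_pos hκ
      rw [sub_pos]
      have hlt : W₀ ⊔ Y₀ < ⊤ := by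
        rw [lt_top_iff_ne_top]
        intro h
        have := hfr _ _ hd₀
        rw [h, finrank_top] at this
        omega
      obtain ⟨v, -, hv⟩ := SetLike.exists_of_lt hlt
      rw [← Nat.card_eq_fintype_card]
      have : Nat.card (W₀ ⊔ Y₀ : Submodule F V) < Nat.card V := by
        rw [Nat.card_eq_fintype_card, Nat.card_eq_fintype_card]
        exact Fintype.card_subtype_lt (x := v) hv
      exact_mod_cast this
    · intro W Y hd
      rw [key W Y hd]
      by_cases hWY : Disjoint W Y
      · simp only [hWY, if_true]
        have : Nat.card (W ⊔ Y : Submodule F V) = Nat.card (W₀ ⊔ Y₀ : Submodule F V) := by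
          apply Nat.card_congr
          exact (LinearEquiv.ofFinrankEq (R := F) _ _ (by
            rw [hfr _ _ hWY, hfr _ _ hd₀]; omega)).toEquiv
        rw [this]
      · simp [hWY]

end
end concrete
end TopHeavy

namespace TopHeavy
set_option linter.unusedSectionVars false

open Module

section concrete
variable {F : Type} [Field F] {V : Type} [AddCommGroup V] [Module F V] [Finite V]

theorem bb_sum (f g : AV F V) : bb f g = ∑ W, f W * bb (del W) g := by
  conv_lhs => rw [sum_del f]
  simp

theorem bb_sum' (f g : AV F V) : bb f g = ∑ W, g W * bb f (del W) := by
  conv_lhs => rw [sum_del g]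
  simp

theorem finiteDim : FiniteDimensional F V := Module.Finite.of_finite

section
variable [Fintype V] [DecidableEq V]

theorem op_LL (c : V → ℝ) : Op bb gr (LL (yy (F := F) (V := V)) c) :=
  LL_op (S := Finset.univ) alg_yy c (fun i hi => absurd (Finset.mem_univ i) hi)
    (fun v _ k f hf => yy_stab v k f hf)

theorem bb_hh {k m : ℕ} {κ : ℝ} (hκ : ∀ W Y : Submodule F V,
    finrank F W + finrank F Y + m = finrank F V →
    bb (del W) ((N1 ^ m) (del Y)) = open Classical in if Disjoint W Y then κ else 0)
    {f : AV F V} (hf : f ∈ gr k) (Y : Submodule F V) (hd : k + finrank F Y + m = finrank F V) :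
    bb f ((N1 ^ m) (del Y)) = κ * hh f Y := by
  classical
  rw [bb_sum, hh, Finset.mul_sum]
  apply Finset.sum_congr rfl
  intro W _
  by_cases hW : finrank F W = k
  · rw [hκ W Y (by omega)]
    split_ifs <;> ring
  · simp [hf W hW]

/-- vanishing of the low degree transforms -/
theorem FF_vanish {k d : ℕ} (μ : Submodule F V → ℝ) (hμ : ∀ Y, (∑ Z, open Classical in if Z ≤ Y then μ Z else 0) = 
      open Classical in if Y = ⊥ then 1 else 0) {f : AV F V} (hf : f ∈ gr k)
    (hd : d ≤ finrank F V - k + 1) 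
    (h : ∀ X : Submodule F V, finrank F X < d → bb f ((N1 ^ (finrank F V - k - finrank F X)) (del X)) = 0) 
    (hk : k ≤ finrank F V)
    (X : Submodule F V) (hX : finrank F X < d) : FF f X = 0 := by
  classical
  have hμ0 : ∀ Y, μ Y ≠ 0 := by
    intro Y hY
    have := mu_sign μ hμ _ Y rfl
    rw [hY, mul_zero] at this
    exact lt_irrefl _ this
  refine FF_zero μ hμ0 f (fun X => ?_) d ?_ X hX
  · rw [hh_eq μ hμ f X]
  · intro X hX
    obtain ⟨κ, hκ, h1⟩ := kappa (F := F) (V := V) (finrank F V - k - finrank F X)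
    have h2 := bb_hh h1 hf X (by omega)
    rw [h X hX] at h2
    exact (mul_eq_zero.1 h2.symm).resolve_left hκ.ne'

theorem HR_one : HR bb (finrank F V) gr (N1 (F := F) (V := V)) := by
  classical
  intro k hk f hf h0 hne
  obtain ⟨μ, hμ⟩ := exists_mu (F := F) (V := V)
  have hF := FF_vanish (d := k) μ hμ hf (by omega) (fun X hX => by
    rw [← (op_LL _).pow_adj, pow_zero_of_le _ h0]
    · simp
    · omega) (by omega)
  obtain ⟨κ, hκ, h1⟩ := kappa (F := F) (V := V) (finrank F V - 2 * k)
  have h2 : bb f ((N1 ^ (finrank F V - 2 * k)) f) = κ * ∑ Y, f Y * hh f Y := by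
    rw [(op_LL _).pow_adj _ f f |>.symm, alg_yy.symm] 
    rw [bb_sum, Finset.mul_sum]
    apply Finset.sum_congr rfl
    intro W _
    by_cases hW : finrank F W = k
    · rw [alg_yy.symm, (op_LL _).pow_adj, bb_hh h1 hf W (by omega)]
      ring
    · simp [hf W hW]
  have h3 : ∑ Y, f Y * hh f Y = ∑ Z, μ Z * FF f Z ^ 2 := by
    simp_rw [hh_eq μ hμ, Finset.mul_sum]
    rw [Finset.sum_comm]
    apply Finset.sum_congr rfl
    intro Z _
    have : FF f Z ^ 2 = ∑ Y, (if Z ≤ Y then f Y else 0) * FF f Z := by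
      rw [← Finset.sum_mul, sq]; rfl
    rw [this, Finset.mul_sum]
    apply Finset.sum_congr rfl
    intro Y _
    split_ifs <;> ring
  have h4 : ∀ Z : Submodule F V, finrank F Z ≠ k → FF f Z = 0 := by
    intro Z hZ
    rcases lt_or_gt_of_ne hZ with h | h
    · exact hF Z h
    · exact FF_big hf Z h
  rw [h2, h3]
  have h5 : (-1) ^ k * (κ * ∑ Z, μ Z * FF f Z ^ 2) =
      κ * ∑ Z, ((-1) ^ k * μ Z) * FF f Z ^ 2 := by
    rw [mul_left_comm, Finset.mul_sum]
    simp_rw [mul_assoc]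
  rw [h5]
  apply mul_pos hκ
  apply Finset.sum_pos'
  · intro Z _
    by_cases hZ : finrank F Z = k
    · exact mul_nonneg (mu_sign μ hμ k Z hZ).le (sq_nonneg _)
    · simp [h4 Z hZ]
  · have : ∃ Z, f Z ≠ 0 := by
      by_contra hcon
      push Not at hcon
      exact hne (funext hcon)
    obtain ⟨Z, hZ⟩ := this
    have hZk : finrank F Z = k := by
      by_contra hcon
      exact hZ (hf Z hcon)
    refine ⟨Z, Finset.mem_univ _, mul_pos (mu_sign μ hμ k Z hZk) ?_⟩
    rw [FF_eq hf Z hZk]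
    positivity

theorem nondeg_low (k : ℕ) (hk : 2 * k ≤ finrank F V) (f : AV F V) (hf : f ∈ gr k)
    (h : ∀ g ∈ gr (finrank F V - k), bb f g = 0) : f = 0 := by
  classical
  obtain ⟨μ, hμ⟩ := exists_mu (F := F) (V := V)
  have hF := FF_vanish (d := finrank F V - k + 1) μ hμ hf (by omega) (fun X hX => by
    apply h
    exact (op_LL _).pow_stab _ (finrank F X) _ (by omega) _ (del_mem X rfl)) (by omega)
  funext X
  by_cases hX : finrank F X = k
  · rw [← FF_eq hf X hX]
    exact hF X (by omega)
  · exact hf X hX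

end

theorem exists_anti : ∃ σ : Submodule F V ≃ (Submodule F V), 
    (∀ W, finrank F (σ W) = finrank F V - finrank F W) ∧
    (∀ W W', IsCompl (σ W) (σ W') ↔ IsCompl W W') := by
  have : FiniteDimensional F V := Module.Finite.of_finite
  let e : Module.Dual F V ≃ₗ[F] V := LinearEquiv.ofFinrankEq _ _ Subspace.dual_finrank_eq
  let τ : Submodule F (Module.Dual F V) ≃o Submodule F V := Submodule.orderIsoMapComap e
  let ρ := Subspace.orderIsoFiniteDimensional (K := F) (V := V)
  let σ := ρ.trans τ.dual
  refine ⟨σ.toEquiv.trans OrderDual.ofDual, ?_, ?_⟩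
  · intro W
    have h1 : finrank F (τ (W.dualAnnihilator)) = finrank F W.dualAnnihilator :=
      LinearEquiv.finrank_map_eq e W.dualAnnihilator
    have h2 := Subspace.finrank_add_finrank_dualAnnihilator_eq W
    change finrank F (τ (W.dualAnnihilator)) = _
    omega
  · intro W W'
    have h1 : IsCompl (σ W) (σ W') ↔ IsCompl W W' := (σ.isCompl_iff (x := W) (y := W')).symm
    rw [← h1]
    exact isCompl_ofDual_iff (a := σ W) (b := σ W')

theorem nondeg_all (k : ℕ) (hk : k ≤ finrank F V) (f : AV F V) (hf : f ∈ gr k)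
    (h : ∀ g ∈ gr (finrank F V - k), bb f g = 0) : f = 0 := by
  classical
  have := Fintype.ofFinite V
  by_cases hk2 : 2 * k ≤ finrank F V
  · exact nondeg_low k hk2 f hf h
  obtain ⟨σ, hσ1, hσ2⟩ := exists_anti (F := F) (V := V)
  have hle : ∀ W : Submodule F V, finrank F W ≤ finrank F V := Submodule.finrank_le
  have hb : ∀ f g : AV F V, bb (fun W => f (σ W)) (fun W => g (σ W)) = bb f g := by
    intro f g
    rw [bb_sum, bb_sum f, ← Equiv.sum_comp σ (fun W => f W * (bb (del W)) g)]
    apply Finset.sum_congr rfl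
    intro W _
    congr 1
    rw [bb_sum', bb_sum' _ g, ← Equiv.sum_comp σ (fun W' => g W' * (bb _) (del W'))]
    apply Finset.sum_congr rfl
    intro W' _
    rw [bb_del, bb_del]
    congr 1
    exact if_congr (hσ2 W W').symm rfl rfl
  have h1 : (fun W => f (σ W)) = 0 := by
    apply nondeg_low (finrank F V - k) (by omega)
    · intro W hW
      apply hf
      rw [hσ1]
      have := hle W
      omega
    · intro g hg
      have := hb f (fun W => g (σ.symm W))
      simp only [Equiv.symm_apply_apply] at this
      rw [this]
      apply h
      intro W hW
      apply hg
      have h2 := hσ1 (σ.symm W)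
      rw [Equiv.apply_symm_apply] at h2
      have := hle W
      have := hle (σ.symm W)
      omega
  funext W
  have := congrFun h1 (σ.symm W)
  simpa using this

theorem sys_gr : Sys bb (finrank F V) (gr (F := F) (V := V)) := by
  have : FiniteDimensional F V := Module.Finite.of_finite
  refine ⟨alg_yy.symm, ?_, nondeg_all⟩
  intro k hk f hf
  funext W
  apply hf
  have := Submodule.finrank_le W
  omega

end concrete
end TopHeavy

namespace TopHeavy
set_option linter.unusedSectionVars false

open Module

section concrete
variable {F : Type} [Field F] {V : Type} [AddCommGroup V] [Module F V] [Finite V]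

instance finQuot (v : V) : Finite (V ⧸ (F ∙ v)) :=
  Finite.of_surjective _ (Submodule.mkQ_surjective (F ∙ v))

open Classical in
/-- contraction by `v` -/
noncomputable def rho (v : V) : AV F V →ₗ[ℝ] AV F (V ⧸ (F ∙ v)) :=
  lin (fun W => if v ∈ W then 0 else del (W.map (F ∙ v).mkQ))

open Classical in
theorem rho_del (v : V) (W : Submodule F V) :
    rho v (del W) = if v ∈ W then 0 else del (W.map (F ∙ v).mkQ) := lin_del _ W

theorem mk_mem_map {v w : V} {W : Submodule F V} :
    (F ∙ v).mkQ w ∈ W.map (F ∙ v).mkQ ↔ w ∈ W ⊔ F ∙ v := by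
  rw [← Submodule.mem_comap, Submodule.comap_map_mkQ, sup_comm]

theorem rho_yy (v w : V) (f : AV F V) :
    rho v (yy w f) = yy ((F ∙ v).mkQ w) (rho v f) := by
  classical
  have : rho v ∘ₗ yy w = yy ((F ∙ v).mkQ w) ∘ₗ rho v := by
    apply ext_del
    intro W
    simp only [LinearMap.comp_apply, yy_del, rho_del]
    by_cases hv : v ∈ W
    · by_cases hw : w ∈ W
      · simp [hv, hw]
      · have : v ∈ W ⊔ F ∙ w := Submodule.mem_sup_left hv
        simp [hv, hw, rho_del, this]
    · rw [if_neg hv, yy_del]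
      by_cases hw : w ∈ W
      · have : (F ∙ v).mkQ w ∈ W.map (F ∙ v).mkQ := Submodule.mem_map_of_mem hw
        rw [if_pos hw, if_pos this, map_zero]
      · rw [if_neg hw, rho_del]
        have h1 : v ∈ W ⊔ F ∙ w ↔ (F ∙ v).mkQ w ∈ W.map (F ∙ v).mkQ := by
          rw [mk_mem_map]
          exact ⟨fun h => mem_sup_span_exchange h hv, fun h => mem_sup_span_exchange h hw⟩
        rw [Submodule.map_sup, Submodule.map_span, Set.image_singleton]
        exact if_congr h1 rfl rfl
  exact LinearMap.congr_fun this f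

theorem isCompl_map {v : V} {W Y : Submodule F V} (hv : v ∉ W) :
    IsCompl W (Y ⊔ F ∙ v) ↔ IsCompl (W.map (F ∙ v).mkQ) (Y.map (F ∙ v).mkQ) := by
  rw [isCompl_iff, isCompl_iff]
  have hc : Codisjoint W (Y ⊔ F ∙ v) ↔ Codisjoint (W.map (F ∙ v).mkQ) (Y.map (F ∙ v).mkQ) := by
    rw [codisjoint_iff, codisjoint_iff, ← Submodule.map_sup, Submodule.map_mkQ_eq_top]
    rw [sup_comm (F ∙ v), sup_assoc]
  have hd : Disjoint W (Y ⊔ F ∙ v) ↔ Disjoint (W.map (F ∙ v).mkQ) (Y.map (F ∙ v).mkQ) := by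
    rw [disjoint_iff, disjoint_iff,
      ← (Submodule.comap_injective_of_surjective (Submodule.mkQ_surjective (F ∙ v))).eq_iff,
      Submodule.comap_inf, Submodule.comap_map_mkQ, Submodule.comap_map_mkQ, Submodule.comap_bot,
      Submodule.ker_mkQ, sup_inf_assoc_of_le _ le_sup_left, sup_comm (F ∙ v) Y]
    constructor
    · intro h
      rw [h, sup_bot_eq]
    · intro h
      have h1 : W ⊓ (Y ⊔ F ∙ v) ≤ F ∙ v := le_sup_right.trans h.le
      have h2 := (le_inf inf_le_left h1).trans (disj_span hv).le_bot
      exact le_bot_iff.1 h2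
  rw [hc, hd]

theorem bb_rho {v : V} (f g : AV F V) : bb f (yy v g) = bb (rho v f) (rho v g) := by
  classical
  have : bb.compl₂ (yy v) = (bb (F := F)).compl₁₂ (rho v) (rho v) := by
    apply ext_del; intro W
    apply ext_del; intro Y
    simp only [LinearMap.compl₁₂_apply, LinearMap.compl₂_apply, yy_del, rho_del]
    by_cases hv : v ∈ W <;> by_cases hy : v ∈ Y
    · simp [hv, hy]
    · have : ¬ IsCompl W (Y ⊔ F ∙ v) := fun h => (isCompl_move hy h.symm).1 hv
      simp [hv, hy, bb_del, this]
    · simp [hv, hy]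
    · rw [if_neg hv, if_neg hy, if_neg hy, bb_del, bb_del]
      exact if_congr (isCompl_map hv) rfl rfl
  exact LinearMap.congr_fun (LinearMap.congr_fun this f) g

theorem rho_gr (v : V) {k : ℕ} {f : AV F V} (hf : f ∈ gr k) : rho v f ∈ gr k := by
  apply gr_induct (rho v) _ _ f hf
  intro W hW
  rw [rho_del]
  split_ifs with h
  · exact Submodule.zero_mem _
  · apply del_mem
    rw [← hW, ← LinearMap.range_domRestrict]
    apply LinearMap.finrank_range_of_inj
    rw [LinearMap.injective_domRestrict_iff, Submodule.ker_mkQ]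
    exact disj_span h

theorem finrank_quot {v : V} (hv : v ≠ 0) : finrank F (V ⧸ (F ∙ v)) + 1 = finrank F V := by
  have : FiniteDimensional F V := Module.Finite.of_finite
  have := Submodule.finrank_quotient_add_finrank (F ∙ v)
  rwa [finrank_span_singleton hv] at this

theorem yy_zero : yy (F := F) (0 : V) = 0 := by
  apply ext_del
  intro W
  simp [yy_del]

theorem eq_yy {Y : Submodule F V} (hY : Y ≠ ⊥) : ∃ v ≠ 0, ∃ Y', yy v (del Y') = del Y := by
  obtain ⟨p, hpY, hp⟩ := Submodule.exists_mem_ne_zero_of_ne_bot hY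
  obtain ⟨Z0, hZ0⟩ := exists_isCompl (F ∙ p)
  refine ⟨p, hp, Z0 ⊓ Y, ?_⟩
  have hsup : (Z0 ⊓ Y) ⊔ F ∙ p = Y := by
    rw [sup_comm, ← sup_inf_assoc_of_le Z0 (by simpa using hpY), hZ0.sup_eq_top, top_inf_eq]
  rw [yy_del, hsup, if_neg]
  exact fun h => not_mem_of_disj hZ0.disjoint.symm hp h.1

section
variable [Fintype V] [DecidableEq V]

theorem rho_LL (v : V) [Fintype (V ⧸ (F ∙ v))] [DecidableEq (V ⧸ (F ∙ v))] (c : V → ℝ)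
    (f : AV F V) : rho v (LL yy c f) =
      LL yy (fun u => ∑ w, if (F ∙ v).mkQ w = u then c w else 0) (rho v f) := by
  simp only [LL, LinearMap.sum_apply, LinearMap.smul_apply, map_sum, map_smul, rho_yy,
    Finset.sum_smul]
  rw [Finset.sum_comm]
  apply Finset.sum_congr rfl
  intro w _
  rw [Finset.sum_eq_single ((F ∙ v).mkQ w)]
  · simp
  · intro u _ hu
    rw [if_neg hu.symm, zero_smul]
  · simp

theorem rho_LL_pow (v : V) [Fintype (V ⧸ (F ∙ v))] [DecidableEq (V ⧸ (F ∙ v))] (c : V → ℝ) (m : ℕ)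
    (f : AV F V) : rho v ((LL yy c ^ m) f) =
      (LL yy (fun u => ∑ w, if (F ∙ v).mkQ w = u then c w else 0) ^ m) (rho v f) := by
  induction m with
  | zero => simp
  | succ m ih => rw [← app_pow_succ, rho_LL, ih, app_pow_succ]

end

theorem HR_all (n : ℕ) : ∀ (V : Type) [AddCommGroup V] [Module F V] [Fintype V] [DecidableEq V],
    finrank F V = n → ∀ c : V → ℝ, (∀ v, 0 < c v) →
      HR bb n gr (LL (yy (F := F) (V := V)) c) := by
  classical
  induction n with
  | zero =>
    intro V _ _ _ _ hn c hc k hk f hf h0 hne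
    obtain rfl : k = 0 := by omega
    have := HR_one (F := F) (V := V)
    rw [hn] at this
    have h1 : (N1 (F := F) (V := V) ^ (0 - 2 * 0 + 1)) f = 0 := by
      rw [← hn]
      have hs := sys_gr (F := F) (V := V)
      rw [hn] at hs
      apply hs.top 1 (by omega)
      rw [hn]
      exact (op_LL _).pow_stab _ 0 _ (by omega) _ hf
    have := this 0 hk f hf h1 hne
    simpa using this
  | succ n ih =>
    intro V _ _ _ _ hn c hc
    have hs := sys_gr (F := F) (V := V)
    rw [hn] at hs
    have HL : ∀ c : V → ℝ, (∀ v, 0 < c v) → ∀ k, 2 * k < n + 1 → ∀ g ∈ gr (F := F) (V := V) k,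
        ((LL yy c) ^ (n + 1 - 2 * k)) g = 0 → g = 0 := by
      intro c hc k hk g hg h0
      have hterm : ∀ v : V, v ≠ 0 → (0 ≤ (-1) ^ k * bb g (yy v ((LL yy c ^ (n - 2 * k)) g))) ∧
          ((-1) ^ k * bb g (yy v ((LL yy c ^ (n - 2 * k)) g)) = 0 → rho v g = 0) := by
        intro v hv
        have := Fintype.ofFinite (V ⧸ (F ∙ v))
        have hfr := finrank_quot (F := F) hv
        have hpos : ∀ u : V ⧸ (F ∙ v), 0 < ∑ w, if (F ∙ v).mkQ w = u then c w else 0 := by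
          intro u
          obtain ⟨w, hw⟩ := Submodule.mkQ_surjective _ u
          apply Finset.sum_pos'
          · intro w _
            split_ifs
            · exact (hc w).le
            · exact le_rfl
          · refine ⟨w, Finset.mem_univ _, ?_⟩
            rw [if_pos hw]
            exact hc w
        have h1 := ih (V ⧸ (F ∙ v)) (by omega) _ hpos k (by omega) (rho v g) (rho_gr v hg) (by
          rw [← rho_LL_pow, show n - 2 * k + 1 = n + 1 - 2 * k by omega, h0, map_zero])
        rw [bb_rho, rho_LL_pow]
        by_cases hz : rho v g = 0
        · simp [hz]
        · have := h1 hz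
          exact ⟨this.le, fun h => absurd h this.ne'⟩
      have hsum : ∑ v, c v * ((-1) ^ k * bb g (yy v ((LL yy c ^ (n - 2 * k)) g))) = 0 := by
        have h2 : bb g ((LL yy c ^ (n + 1 - 2 * k)) g) = 0 := by rw [h0, map_zero]
        rw [show n + 1 - 2 * k = n - 2 * k + 1 by omega, ← app_pow_succ] at h2
        have h3 : bb g (LL yy c ((LL yy c ^ (n - 2 * k)) g)) =
            ∑ v, c v * bb g (yy v ((LL yy c ^ (n - 2 * k)) g)) := by
          generalize (LL yy c ^ (n - 2 * k)) g = z
          rw [LL, LinearMap.sum_apply, map_sum]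
          apply Finset.sum_congr rfl
          intro v _
          rw [LinearMap.smul_apply, map_smul, smul_eq_mul]
        rw [h3] at h2
        have h4 := congrArg (fun t => (-1) ^ k * t) h2
        simp only [Finset.mul_sum, mul_zero] at h4
        rw [← h4]
        apply Finset.sum_congr rfl
        intro v _
        ring
      have hnn : ∀ v ∈ Finset.univ, 0 ≤ c v * ((-1) ^ k * bb g (yy v ((LL yy c ^ (n - 2 * k)) g))) := by
        intro v _
        by_cases hv : v = 0
        · rw [hv, yy_zero]; simp
        · exact mul_nonneg (hc v).le (hterm v hv).1
      have hz := (Finset.sum_eq_zero_iff_of_nonneg hnn).1 hsum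
      have hrho : ∀ v, v ≠ 0 → rho v g = 0 := by
        intro v hv
        apply (hterm v hv).2
        exact (mul_eq_zero.1 (hz v (Finset.mem_univ _))).resolve_left (hc v).ne'
      apply hs.nondeg k (by omega) g hg
      intro g' hg'
      have := gr_induct (bb g) ⊥ (fun Y hY => ?_) g' hg'
      · simpa using this
      · have hYb : Y ≠ ⊥ := by
          rintro rfl
          rw [finrank_bot] at hY
          omega
        obtain ⟨v, hv, Y', hY'⟩ := eq_yy hYb
        rw [← hY', bb_rho, hrho v hv]
        simp
    have hcomb : ∀ s : ℝ, LL yy (fun _ => 1) + s • LL (yy (F := F) (V := V)) (fun v => c v - 1) =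
        LL yy (fun v => (1 - s) + s * c v) := by
      intro s
      simp only [LL]
      rw [Finset.smul_sum, ← Finset.sum_add_distrib]
      apply Finset.sum_congr rfl
      intro v _
      rw [smul_smul, ← add_smul]
      congr 1
      ring
    have h1 := HR_one (F := F) (V := V)
    rw [hn] at h1
    have := deform_HR hs (op_LL (fun _ => 1)) (op_LL (fun v => c v - 1)) (fun s hs k hk g hg h0 => by
      rw [hcomb] at h0
      refine HL _ (fun v => ?_) k hk g hg h0
      have := hc v
      rcases hs.1.eq_or_lt with h | h
      · rw [← h]; norm_num
      · have := mul_pos h this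
        linarith [hs.2]) h1
    have h2 := hcomb 1
    rw [one_smul] at h2
    rw [h2] at this
    simpa using this

theorem good_all [Fintype V] [DecidableEq V] :
    Good bb (yy (F := F) (V := V)) (finrank F V) Finset.univ gr where
  stab := fun v _ k x hx => yy_stab v k x hx
  top := sys_gr.top
  nondeg := sys_gr.nondeg
  hr := fun c hc _ => HR_all _ V rfl c (fun v => hc v (Finset.mem_univ v))

end concrete
end TopHeavy

namespace TopHeavy
set_option linter.unusedSectionVars false

open Module

section concrete
variable {F : Type} [Field F] {V : Type} [AddCommGroup V] [Module F V] [Fintype V] [DecidableEq V]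

theorem yy_apply_sum (v : V) (f : AV F V) (X : Submodule F V) :
    yy v f X = ∑ W, f W * yy v (del W) X := by
  conv_lhs => rw [sum_del f]
  simp

theorem yy_del_nonneg (v : V) (W X : Submodule F V) : 0 ≤ yy v (del W) X := by
  rw [yy_del]
  split_ifs
  · simp
  · rw [del_apply]; split_ifs <;> simp

theorem pow_pos_entry (S : Finset V) (hS : Submodule.span F (S : Set V) = ⊤) (c : V → ℝ)
    (hc : ∀ v, 0 ≤ c v) (hcS : ∀ v ∈ S, 0 < c v) (m : ℕ) (hm : m ≤ finrank F V) :
    (∀ W, 0 ≤ (LL yy c ^ m) (del (⊥ : Submodule F V)) W) ∧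
    ∃ W, 0 < (LL yy c ^ m) (del (⊥ : Submodule F V)) W := by
  induction m with
  | zero =>
    constructor
    · intro W
      rw [pow_zero, Module.End.one_apply, del_apply]; split_ifs <;> simp
    · refine ⟨⊥, ?_⟩
      rw [pow_zero, Module.End.one_apply, del_apply]; simp
  | succ m ih =>
    obtain ⟨h1, W, hW⟩ := ih (by omega)
    have hgr : (LL yy c ^ m) (del (⊥ : Submodule F V)) ∈ gr m :=
      (op_LL c).pow_stab m 0 m (by omega) _ (del_mem _ (finrank_bot _ _))
    rw [← app_pow_succ]
    generalize (LL yy c ^ m) (del (⊥ : Submodule F V)) = f at *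
    have hy : ∀ v X, 0 ≤ yy v f X := by
      intro v X
      rw [yy_apply_sum]
      exact Finset.sum_nonneg (fun W _ => mul_nonneg (h1 W) (yy_del_nonneg v W X))
    have hN : ∀ X, LL yy c f X = ∑ v, c v * yy v f X := by
      intro X
      simp [LL]
    refine ⟨fun X => ?_, ?_⟩
    · rw [hN]
      exact Finset.sum_nonneg (fun v _ => mul_nonneg (hc v) (hy v X))
    · have hWm : finrank F W = m := by
        by_contra h
        exact hW.ne' (hgr W h)
      have : ∃ v ∈ S, v ∉ W := by
        by_contra hcon
        push Not at hcon
        have : Submodule.span F (S : Set V) ≤ W := Submodule.span_le.2 hcon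
        rw [hS, top_le_iff] at this
        rw [this, finrank_top] at hWm
        omega
      obtain ⟨v, hvS, hv⟩ := this
      refine ⟨W ⊔ F ∙ v, ?_⟩
      rw [hN]
      apply Finset.sum_pos' (fun v _ => mul_nonneg (hc v) (hy v _))
      refine ⟨v, Finset.mem_univ _, mul_pos (hcS v hvS) ?_⟩
      rw [yy_apply_sum]
      apply Finset.sum_pos' (fun W _ => mul_nonneg (h1 W) (yy_del_nonneg v W _))
      refine ⟨W, Finset.mem_univ _, mul_pos hW ?_⟩
      rw [yy_del, if_neg hv, del_apply, if_pos rfl]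
      exact one_pos

theorem exists_good (S : Finset V) (hS : Submodule.span F (S : Set V) = ⊤) :
    ∃ B, Good bb (yy (F := F) (V := V)) (finrank F V) S B ∧ del ⊥ ∈ B 0 ∧
      B 0 ≤ Submodule.span ℝ {del (⊥ : Submodule F V)} := by
  have main : ∀ T : Finset V, Disjoint S T → ∃ B, Good bb (yy (F := F) (V := V)) (finrank F V)
      (Finset.univ \ T) B ∧ del ⊥ ∈ B 0 ∧
      B 0 ≤ Submodule.span ℝ {del (⊥ : Submodule F V)} := by
    intro T
    induction T using Finset.induction_on with
    | empty =>
      intro _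
      refine ⟨gr, by simpa using good_all, del_mem _ (finrank_bot _ _), ?_⟩
      intro f hf
      rw [Submodule.mem_span_singleton]
      refine ⟨f ⊥, ?_⟩
      funext W
      by_cases hW : W = ⊥
      · subst hW; simp [del_apply]
      · rw [hf W (fun h => hW (Submodule.finrank_eq_zero.1 h))]
        simp [del_apply, hW]
    | insert e T he ih =>
      intro hd
      rw [Finset.disjoint_insert_right] at hd
      obtain ⟨B, hG, ho, hB0⟩ := ih hd.2
      rw [Finset.sdiff_insert]
      have heT : e ∈ Finset.univ \ T := by simp [he]
      let c : V → ℝ := fun v => if v ∈ (Finset.univ \ T).erase e then 1 else 0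
      refine delete alg_yy hG heT (c := c) ?_ ?_ ho hB0 ?_
      · intro i hi
        simp only [c, if_pos hi, one_pos]
      · intro i hi
        simp only [c, if_neg hi]
      · have h1 := (pow_pos_entry S hS c (fun v => by
          simp only [c]; split_ifs <;> simp) (fun v hv => by
          have : v ∈ (Finset.univ \ T).erase e := by
            rw [Finset.mem_erase, Finset.mem_sdiff]
            exact ⟨fun h => hd.1 (h ▸ hv), Finset.mem_univ _, Finset.disjoint_left.1 hd.2 hv⟩
          simp only [c, if_pos this, one_pos]) (finrank F V) le_rfl).2
        obtain ⟨W, hW⟩ := h1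
        intro h
        rw [h] at hW
        exact lt_irrefl _ hW
  obtain ⟨B, h⟩ := main (Finset.univ \ S) Finset.disjoint_sdiff
  rw [sdiff_sdiff_right_self, inf_of_le_right (Finset.subset_univ S)] at h
  exact ⟨B, h⟩

variable (F) in
/-- subspaces spanned by subsets of `S` -/
def FS (S : Finset V) : Set (Submodule F V) := {W | ∃ A ⊆ S, Submodule.span F (A : Set V) = W}

theorem del_mem_B {S : Finset V} {B : ℕ → Submodule ℝ (AV F V)} {n : ℕ}
    (hG : Good bb (yy (F := F) (V := V)) n S B) (ho : del ⊥ ∈ B 0) (A : Finset V) (hA : A ⊆ S) :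
    del (Submodule.span F (A : Set V)) ∈ B (finrank F (Submodule.span F (A : Set V))) := by
  induction A using Finset.induction_on with
  | empty => rw [Finset.coe_empty, Submodule.span_empty, finrank_bot]; exact ho
  | insert v A hv ih =>
    rw [Finset.insert_subset_iff] at hA
    have ih := ih hA.2
    rw [Finset.coe_insert, Submodule.span_insert, sup_comm]
    generalize Submodule.span F (A : Set V) = W at *
    by_cases hvW : v ∈ W
    · rw [sup_eq_left.2 (by simpa using hvW)]
      exact ih
    · have := hG.stab v hA.1 _ _ ih
      rw [yy_del, if_neg hvW] at this
      rwa [finrank_sup_span hvW]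

/-- functions supported on `FS` -/
def suppS (S : Finset V) : Submodule ℝ (AV F V) where
  carrier := {f | ∀ W, W ∉ FS F S → f W = 0}
  add_mem' := by
    intro a b ha hb W hW
    simp [ha W hW, hb W hW]
  zero_mem' := fun _ _ => rfl
  smul_mem' := by
    intro c a ha W hW
    simp [ha W hW]

theorem del_suppS {S : Finset V} {W : Submodule F V} (hW : W ∈ FS F S) : del W ∈ suppS S := by
  intro W' hW'
  have : W' ≠ W := by rintro rfl; exact hW' hW
  simp [del_apply, this]

theorem yy_suppS {S : Finset V} {v : V} (hv : v ∈ S) {f : AV F V} (hf : f ∈ suppS S) :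
    yy v f ∈ suppS S := by
  rw [sum_del f, map_sum]
  apply Submodule.sum_mem
  intro W _
  rw [map_smul]
  by_cases hW : W ∈ FS F S
  · apply Submodule.smul_mem
    rw [yy_del]
    split_ifs with h
    · exact Submodule.zero_mem _
    · apply del_suppS
      obtain ⟨A, hA, rfl⟩ := hW
      refine ⟨insert v A, Finset.insert_subset hv hA, ?_⟩
      rw [Finset.coe_insert, Submodule.span_insert, sup_comm]
  · rw [hf W hW, zero_smul]
    exact Submodule.zero_mem _

theorem count (S : Finset V) (hS : Submodule.span F (S : Set V) = ⊤) (k : ℕ)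
    (hk : 2 * k ≤ finrank F V) :
    Nat.card {W : Submodule F V // W ∈ FS F S ∧ finrank F W = k} ≤
      Nat.card {W : Submodule F V // W ∈ FS F S ∧ finrank F W = finrank F V - k} := by
  classical
  obtain ⟨B, hG, ho, -⟩ := exists_good S hS
  let c : V → ℝ := fun v => if v ∈ S then 1 else 0
  have hc0 : ∀ i, i ∉ S → c i = 0 := fun i hi => by simp only [c, if_neg hi]
  have hHR := hG.hr c (fun i hi => by simp only [c, if_pos hi, one_pos]) hc0 k hk
  let d := finrank F V - 2 * k
  have hinj : ∀ x ∈ B k, (LL yy c ^ d) x = 0 → x = 0 := by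
    intro x hx h0
    by_contra hne
    have := hHR x hx (pow_zero_of_le (Nat.le_succ d) h0) hne
    rw [h0] at this
    simp at this
  have hsupp : ∀ m, ∀ x ∈ suppS S, (LL yy c ^ m) x ∈ suppS (F := F) S := by
    intro m
    induction m with
    | zero => intro x hx; simpa using hx
    | succ m ih =>
      intro x hx
      rw [← app_pow_succ]
      exact LL_mem c hc0 _ _ (fun v hv => yy_suppS hv (ih x hx))
  let P := {W : Submodule F V // W ∈ FS F S ∧ finrank F W = k}
  let Q := {W : Submodule F V // W ∈ FS F S ∧ finrank F W = finrank F V - k}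
  let i : (P → ℝ) →ₗ[ℝ] AV F V := Fintype.linearCombination ℝ (fun W : P => del W.1)
  have hi : ∀ a : P → ℝ, i a = ∑ W : P, a W • del W.1 := fun a => Fintype.linearCombination_apply ..
  let j : AV F V →ₗ[ℝ] (Q → ℝ) := LinearMap.funLeft ℝ ℝ (fun W : Q => W.1)
  have hT : Function.Injective (j ∘ₗ (LL yy c ^ d) ∘ₗ i) := by
    rw [← LinearMap.ker_eq_bot, LinearMap.ker_eq_bot']
    intro a ha
    have hiS : i a ∈ suppS S := by
      rw [hi]
      exact Submodule.sum_mem _ (fun W _ => Submodule.smul_mem _ _ (del_suppS W.2.1))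
    have hig : i a ∈ gr k := by
      rw [hi]
      exact Submodule.sum_mem _ (fun W _ => Submodule.smul_mem _ _ (del_mem _ W.2.2))
    have hiB : i a ∈ B k := by
      rw [hi]
      refine Submodule.sum_mem _ (fun W _ => Submodule.smul_mem _ _ ?_)
      obtain ⟨W, ⟨A, hA, rfl⟩, hW⟩ := W
      have := del_mem_B hG ho A hA
      rwa [hW] at this
    have h1 : (LL yy c ^ d) (i a) = 0 := by
      funext W
      by_cases hW : W ∈ FS F S ∧ finrank F W = finrank F V - k
      · exact congrFun ha ⟨W, hW⟩
      · rw [not_and_or] at hW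
        rcases hW with hW | hW
        · exact hsupp d _ hiS W hW
        · have : (LL yy c ^ d) (i a) ∈ gr (finrank F V - k) :=
            (op_LL c).pow_stab d k _ (by omega) _ hig
          exact this W hW
    have h2 := hinj _ hiB h1
    funext W
    have h3 := congrFun h2 W.1
    rw [hi, Finset.sum_apply, Finset.sum_eq_single W] at h3
    · simpa [del_apply] using h3
    · intro W' _ hne
      have : W.1 ≠ W'.1 := fun h => hne (Subtype.ext h.symm)
      simp [del_apply, this]
    · simp
  have := LinearMap.finrank_le_finrank_of_injective hT
  rwa [Module.finrank_fintype_fun_eq_card, Module.finrank_fintype_fun_eq_card,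
    ← Nat.card_eq_fintype_card, ← Nat.card_eq_fintype_card] at this

end concrete
end TopHeavy

namespace TopHeavy
set_option linter.unusedSectionVars false
open Module

theorem jac_int : IsJacobsonRing ℤ := by
  rw [isJacobsonRing_iff_prime_eq]
  intro P hP
  by_cases hb : P = ⊥
  · subst hb
    rw [eq_bot_iff]
    intro x hx
    rw [Ideal.mem_jacobson_bot] at hx
    have h1 := hx x
    have h2 := hx (-x)
    rw [Int.isUnit_iff] at h1 h2
    rw [Submodule.mem_bot]
    rcases h1 with h1 | h1 <;> nlinarith
  · have := IsPrime.to_maximal_ideal (hpi := hP) hb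
    exact Ideal.jacobson_eq_self_of_isMaximal

theorem finite_field_of_finiteType (k : Type) [Field k] [Algebra.FiniteType ℤ k] : Finite k := by
  have := jac_int
  have hfin : Module.Finite ℤ k := finite_of_finite_type_of_isJacobsonRing ℤ k
  apply Module.finite_of_fg_torsion
  have hni : ¬ Function.Injective (algebraMap ℤ k) := by
    intro h
    have := isField_of_isIntegral_of_isField h (Field.toIsField k)
    exact Int.not_isField this
  rw [injective_iff_map_eq_zero] at hni
  push Not at hni
  obtain ⟨p, hp, hp0⟩ := hni
  intro x
  refine ⟨⟨p, mem_nonZeroDivisors_of_ne_zero hp0⟩, ?_⟩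
  change p • x = 0
  rw [zsmul_eq_mul]
  have : (p : k) = 0 := by simpa using hp
  rw [this, zero_mul]

theorem finite_field_of_surj (A k : Type) [CommRing A] [Algebra ℤ A] [Algebra.FiniteType ℤ A]
    [Field k] (f : A →+* k) (hf : Function.Surjective f) : Finite k := by
  let g : A →ₐ[ℤ] k := { f with commutes' := fun n => by simp }
  have : Algebra.FiniteType ℤ k := Algebra.FiniteType.of_surjective g hf
  exact finite_field_of_finiteType k

theorem exists_reduction (K : Type) [Field K] (X : Set K) (hX : X.Finite) :
    ∃ (R : Subalgebra ℤ K) (k : Type) (_ : Field k) (_ : Finite k) (_ : R →+* k), X ⊆ R := by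
  let R := Algebra.adjoin ℤ X
  have hR : Algebra.FiniteType ℤ R := Algebra.FiniteType.adjoin_of_finite hX
  obtain ⟨m, hm⟩ := Ideal.exists_maximal R
  let : Field (R ⧸ m) := Ideal.Quotient.field m
  exact ⟨R, R ⧸ m, inferInstance, finite_field_of_surj R _ (Ideal.Quotient.mk m)
    Ideal.Quotient.mk_surjective, Ideal.Quotient.mk m, Algebra.subset_adjoin⟩

theorem indep_dual {K : Type} [Field K] {E : Type*} [DecidableEq E] {m : ℕ} {ψ : E → Fin m → K}
    {I : Finset E} (h : LinearIndepOn K ψ (I : Set E)) :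
    ∃ a : E → Fin m → K, ∀ i ∈ I, ∀ i' ∈ I, ∑ j, a i j * ψ i' j = if i' = i then 1 else 0 := by
  have h1 : LinearIndependent K (fun e : I => ψ e) := h
  have h2 := h1.fintypeLinearCombination_injective
  obtain ⟨g, hg⟩ := LinearMap.exists_leftInverse_of_injective _ (LinearMap.ker_eq_bot.2 h2)
  refine ⟨fun i j => if hi : i ∈ I then g (Pi.single j 1) ⟨i, hi⟩ else 0, ?_⟩
  intro i hi i' hi'
  have h3 : g (ψ i') = Pi.single (⟨i', hi'⟩ : I) 1 := by
    have := LinearMap.congr_fun hg (Pi.single (⟨i', hi'⟩ : I) 1)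
    simpa using this
  have h4 : g (ψ i') = ∑ j, ψ i' j • g (Pi.single j 1) := by
    conv_lhs => rw [pi_eq_sum_univ' (ψ i')]
    simp only [map_sum, map_smul]
  have h5 := congrFun (h4.symm.trans h3) ⟨i, hi⟩
  simp only [Finset.sum_apply, Pi.smul_apply, smul_eq_mul] at h5
  simp only [hi, dif_pos]
  rw [Finset.sum_congr rfl (fun j _ => mul_comm _ _), h5, Pi.single_apply]
  simp [eq_comm]

theorem dual_indep {K : Type} [Field K] {E : Type*} [DecidableEq E] {m : ℕ} {ψ : E → Fin m → K}
    {I : Finset E} (a : E → Fin m → K)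
    (h : ∀ i ∈ I, ∀ i' ∈ I, ∑ j, a i j * ψ i' j = if i' = i then 1 else 0) :
    LinearIndepOn K ψ (I : Set E) := by
  rw [linearIndepOn_finset_iff]
  intro f hf i hi
  have h1 : ∑ j, a i j * (∑ e ∈ I, f e • ψ e) j = 0 := by rw [hf]; simp
  simp only [Finset.sum_apply, Pi.smul_apply, smul_eq_mul, Finset.mul_sum] at h1
  rw [Finset.sum_comm] at h1
  have h2 : ∀ e ∈ I, ∑ j, a i j * (f e * ψ e j) = if e = i then f e else 0 := by
    intro e he
    have := h i hi e he
    calc _ = f e * ∑ j, a i j * ψ e j := by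
          rw [Finset.mul_sum]; exact Finset.sum_congr rfl (fun _ _ => by ring)
      _ = _ := by rw [this]; simp
  rw [Finset.sum_congr rfl h2, Finset.sum_ite_eq' I i, if_pos hi] at h1
  exact h1

theorem dep_coeff {K : Type} [Field K] {E : Type*} [DecidableEq E] {m : ℕ} {ψ : E → Fin m → K}
    {I : Finset E} (h : ¬ LinearIndepOn K ψ (I : Set E)) :
    ∃ c : E → K, (∀ j, ∑ e ∈ I, c e * ψ e j = 0) ∧ ∃ e ∈ I, c e = 1 := by
  rw [linearIndepOn_finset_iff] at h
  push Not at h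
  obtain ⟨f, hf, i, hi, h0⟩ := h
  refine ⟨fun e => (f i)⁻¹ * f e, fun j => ?_, i, hi, inv_mul_cancel₀ h0⟩
  have := congrFun hf j
  simp only [Finset.sum_apply, Pi.smul_apply, smul_eq_mul, Pi.zero_apply] at this
  simp only [mul_assoc]
  rw [← Finset.mul_sum, this, mul_zero]

theorem coeff_dep {K : Type} [Field K] {E : Type*} [DecidableEq E] {m : ℕ} {ψ : E → Fin m → K}
    {I : Finset E} (c : E → K) (h : ∀ j, ∑ e ∈ I, c e * ψ e j = 0) (h1 : ∃ e ∈ I, c e = 1) :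
    ¬ LinearIndepOn K ψ (I : Set E) := by
  rw [linearIndepOn_finset_iff]
  push Not
  obtain ⟨e, he, h1⟩ := h1
  refine ⟨c, ?_, e, he, by rw [h1]; exact one_ne_zero⟩
  funext j
  simpa using h j

theorem reduce_field {K : Type} [Field K] {E : Type*} [Finite E] [DecidableEq E] {m : ℕ}
    (ψ : E → Fin m → K) :
    ∃ (k : Type) (_ : Field k) (_ : Finite k) (ψ' : E → Fin m → k), ∀ I : Finset E,
      LinearIndepOn K ψ (I : Set E) ↔ LinearIndepOn k ψ' (I : Set E) := by
  classical
  have hA : ∀ I : Finset E, ∃ a : E → Fin m → K, LinearIndepOn K ψ (I : Set E) →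
      ∀ i ∈ I, ∀ i' ∈ I, ∑ j, a i j * ψ i' j = if i' = i then 1 else 0 := by
    intro I
    by_cases h : LinearIndepOn K ψ (I : Set E)
    · obtain ⟨a, ha⟩ := indep_dual h
      exact ⟨a, fun _ => ha⟩
    · exact ⟨0, fun h' => absurd h' h⟩
  choose a ha using hA
  have hC : ∀ I : Finset E, ∃ c : E → K, ¬ LinearIndepOn K ψ (I : Set E) →
      (∀ j, ∑ e ∈ I, c e * ψ e j = 0) ∧ ∃ e ∈ I, c e = 1 := by
    intro I
    by_cases h : LinearIndepOn K ψ (I : Set E)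
    · exact ⟨0, fun h' => absurd h h'⟩
    · obtain ⟨a, ha⟩ := dep_coeff h
      exact ⟨a, fun _ => ha⟩
  choose c hc using hC
  let X : Set K := Set.range (fun p : E × Fin m => ψ p.1 p.2) ∪
    (Set.range (fun p : Finset E × E × Fin m => a p.1 p.2.1 p.2.2) ∪
      Set.range (fun p : Finset E × E => c p.1 p.2))
  have hX : X.Finite := (Set.finite_range _).union ((Set.finite_range _).union (Set.finite_range _))
  obtain ⟨R, k, _, _, q, hR⟩ := exists_reduction K X hX
  have h1 : ∀ e j, ψ e j ∈ R := fun e j => hR (Or.inl ⟨(e, j), rfl⟩)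
  have h2 : ∀ I e j, a I e j ∈ R := fun I e j => hR (Or.inr (Or.inl ⟨(I, e, j), rfl⟩))
  have h3 : ∀ I e, c I e ∈ R := fun I e => hR (Or.inr (Or.inr ⟨(I, e), rfl⟩))
  refine ⟨k, inferInstance, inferInstance, fun e j => q ⟨ψ e j, h1 e j⟩, fun I => ⟨?_, ?_⟩⟩
  · intro h
    apply dual_indep (fun e j => q ⟨a I e j, h2 I e j⟩)
    intro i hi i' hi'
    have h4 : ∑ j, (⟨a I i j, h2 I i j⟩ : R) * ⟨ψ i' j, h1 i' j⟩ = if i' = i then 1 else 0 := by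
      apply Subtype.ext
      have := ha I h i hi i' hi'
      push_cast
      rw [this]
      split_ifs <;> simp
    have h5 := congrArg q h4
    simp only [map_sum, map_mul] at h5
    rw [h5]
    split_ifs <;> simp
  · intro h
    by_contra hn
    obtain ⟨h4, e, he, h5⟩ := hc I hn
    refine coeff_dep (fun e => q ⟨c I e, h3 I e⟩) (fun j => ?_) ⟨e, he, ?_⟩ h
    · have h6 : ∑ e ∈ I, (⟨c I e, h3 I e⟩ : R) * ⟨ψ e j, h1 e j⟩ = 0 := by
        apply Subtype.ext
        push_cast
        exact h4 j
      have h7 := congrArg q h6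
      simpa only [map_sum, map_mul, map_zero] using h7
    · have : (⟨c I e, h3 I e⟩ : R) = 1 := Subtype.ext h5
      rw [this, map_one]

end TopHeavy

namespace TopHeavy
set_option linter.unusedSectionVars false
open Module

section fin
variable {K : Type} [Field K] {V : Type} [AddCommGroup V] [Module K V] {E : Type*} [Fintype E]
  [DecidableEq E]

theorem to_span (φ : E → V) : ∃ φ' : E → Submodule.span K (Set.range φ),
    Submodule.span K (Set.range φ') = ⊤ ∧
    ∀ I : Set E, LinearIndepOn K φ I ↔ LinearIndepOn K φ' I := by
  refine ⟨fun e => ⟨φ e, Submodule.subset_span ⟨e, rfl⟩⟩, ?_, ?_⟩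
  · have := Submodule.span_span_coe_preimage (R := K) (s := Set.range φ)
    rw [← this]
    congr 1
    ext ⟨x, hx⟩
    simp [Subtype.ext_iff]
  · intro I
    exact LinearMap.linearIndependent_iff
      (v := fun e : I => (⟨φ e, Submodule.subset_span ⟨e, rfl⟩⟩ : Submodule.span K (Set.range φ)))
      (Submodule.span K (Set.range φ)).subtype (Submodule.ker_subtype _)

theorem to_coords (φ : E → V) : ∃ (m : ℕ) (ψ : E → Fin m → K),
    ∀ I : Set E, LinearIndepOn K φ I ↔ LinearIndepOn K ψ I := by
  obtain ⟨φ', -, h⟩ := to_span (K := K) φ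
  have : FiniteDimensional K (Submodule.span K (Set.range φ)) :=
    FiniteDimensional.span_of_finite K (Set.finite_range φ)
  generalize Submodule.span K (Set.range φ) = W at *
  obtain ⟨m, ⟨b⟩⟩ : ∃ m, Nonempty (W ≃ₗ[K] (Fin m → K)) :=
    ⟨_, ⟨(Module.finBasis K W).equivFun⟩⟩
  refine ⟨m, fun e => b (φ' e), fun I => ?_⟩
  rw [h]
  exact (LinearMap.linearIndependent_iff (v := fun e : I => φ' e)
    (b : W →ₗ[K] (Fin m → K)) (LinearEquiv.ker b)).symm

variable [Finite V] (M : FinMatroid E) (φ : E → V)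

theorem rank_eq (hφ : ∀ I : Finset E, M.Indep I ↔ LinearIndepOn K φ (I : Set E))
    (A : Finset E) : M.rank A = finrank K (Submodule.span K (φ '' (A : Set E))) := by
  classical
  have : FiniteDimensional K V := Module.Finite.of_finite
  have hcard : ∀ I : Finset E, M.Indep I →
      finrank K (Submodule.span K (φ '' (I : Set E))) = I.card := by
    intro I hI
    have h1 : LinearIndependent K (fun e : I => φ e) := (hφ I).1 hI
    have h2 := finrank_span_eq_card h1
    rw [Fintype.card_coe] at h2
    rw [← h2, Set.image_eq_range]
    rfl
  apply le_antisymm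
  · apply Finset.sup_le
    intro I hI
    rw [Finset.mem_filter, Finset.mem_powerset] at hI
    rw [← hcard I hI.2]
    exact Submodule.finrank_mono (Submodule.span_mono (Set.image_mono (by exact_mod_cast hI.1)))
  · obtain ⟨b, hb, -, hs, hli⟩ := exists_linearIndepOn_extension
      (linearIndepOn_empty K φ) (Set.empty_subset (A : Set E))
    have hbf : b.Finite := Set.toFinite b
    have hcoe : ((hbf.toFinset : Finset E) : Set E) = b := hbf.coe_toFinset
    have hI : M.Indep hbf.toFinset := by rw [hφ, hcoe]; exact hli
    have h1 : finrank K (Submodule.span K (φ '' (A : Set E))) ≤ hbf.toFinset.card := by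
      rw [← hcard _ hI, hcoe]
      exact Submodule.finrank_mono (Submodule.span_le.2 hs)
    refine h1.trans (Finset.le_sup (f := Finset.card) ?_)
    rw [Finset.mem_filter, Finset.mem_powerset]
    refine ⟨?_, hI⟩
    rw [← Finset.coe_subset, hcoe]
    exact hb

theorem isFlat_iff (hφ : ∀ I : Finset E, M.Indep I ↔ LinearIndepOn K φ (I : Set E))
    (A : Finset E) : M.IsFlat A ↔
    ∀ x, φ x ∈ Submodule.span K (φ '' (A : Set E)) → x ∈ A := by
  have key : ∀ x, M.rank (insert x A) = M.rank A ↔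
      φ x ∈ Submodule.span K (φ '' (A : Set E)) := by
    intro x
    rw [rank_eq M φ hφ, rank_eq M φ hφ, Finset.coe_insert, Set.image_insert_eq,
      Submodule.span_insert, sup_comm]
    constructor
    · intro h
      by_contra hx
      rw [finrank_sup_span hx] at h
      omega
    · intro h
      rw [sup_eq_left.2 (by simpa using h)]
  constructor
  · intro h x hx
    rw [← h]
    simpa [FinMatroid.closure] using (key x).2 hx
  · intro h
    ext x
    simp only [FinMatroid.closure, Finset.mem_filter, Finset.mem_univ, true_and]
    rw [key]
    exact ⟨h x, fun hx => Submodule.subset_span ⟨x, hx, rfl⟩⟩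

theorem whitney_eq [Fintype V] [DecidableEq V] (hφ : ∀ I : Finset E, M.Indep I ↔ LinearIndepOn K φ (I : Set E))
    (k : ℕ) : M.whitneySecond k =
    Nat.card {W : Submodule K V // W ∈ FS K (Finset.univ.image φ) ∧ finrank K W = k} := by
  classical
  rw [FinMatroid.whitneySecond, ← Fintype.card_subtype, ← Nat.card_eq_fintype_card]
  have hmem : ∀ A : Finset E, Submodule.span K (φ '' (A : Set E)) ∈ FS K (Finset.univ.image φ) :=
    fun A => ⟨A.image φ, Finset.image_subset_image (Finset.subset_univ A), by rw [Finset.coe_image]⟩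
  refine Nat.card_eq_of_bijective (fun A => ⟨Submodule.span K (φ '' (A.1 : Set E)), hmem A.1, by
    rw [← rank_eq M φ hφ]; exact A.2.2⟩) ⟨?_, ?_⟩
  · rintro ⟨A, hA, hAk⟩ ⟨B, hB, hBk⟩ h
    have h1 : Submodule.span K (φ '' (A : Set E)) = Submodule.span K (φ '' (B : Set E)) :=
      congrArg Subtype.val h
    rw [isFlat_iff M φ hφ] at hA hB
    apply Subtype.ext
    ext x
    constructor
    · intro hx
      exact hB x (h1 ▸ Submodule.subset_span ⟨x, hx, rfl⟩)
    · intro hx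
      exact hA x (h1 ▸ Submodule.subset_span ⟨x, hx, rfl⟩)
  · rintro ⟨W, ⟨A, hA, hW⟩, hk⟩
    let B : Finset E := Finset.univ.filter (fun x => φ x ∈ W)
    have hB : Submodule.span K (φ '' (B : Set E)) = W := by
      apply le_antisymm
      · rw [Submodule.span_le]
        rintro _ ⟨x, hx, rfl⟩
        simpa [B] using hx
      · rw [← hW, Submodule.span_le]
        intro v hv
        obtain ⟨x, -, rfl⟩ := Finset.mem_image.1 (hA hv)
        apply Submodule.subset_span
        refine ⟨x, ?_, rfl⟩
        simp only [B, Finset.coe_filter, Finset.mem_univ, true_and, Set.mem_ofPred_eq]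
        rw [← hW]
        exact Submodule.subset_span hv
    refine ⟨⟨B, ?_, ?_⟩, ?_⟩
    · rw [isFlat_iff M φ hφ, hB]
      intro x hx
      simpa [B] using hx
    · rw [rank_eq M φ hφ, hB, hk]
    · exact Subtype.ext hB

theorem final_ineq (hφ : ∀ I : Finset E, M.Indep I ↔ LinearIndepOn K φ (I : Set E))
    (hs : Submodule.span K (Set.range φ) = ⊤) (k : ℕ) (hk : 2 * k ≤ M.rk) :
    M.whitneySecond k ≤ M.whitneySecond (M.rk - k) := by
  classical
  have := Fintype.ofFinite V
  have hr : M.rk = finrank K V := by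
    rw [FinMatroid.rk, rank_eq M φ hφ, Finset.coe_univ, Set.image_univ, hs, finrank_top]
  rw [whitney_eq M φ hφ, whitney_eq M φ hφ, hr]
  apply count
  · rw [Finset.coe_image, Finset.coe_univ, Set.image_univ, hs]
  · omega

end fin

theorem main_thm {E : Type*} [Fintype E] [DecidableEq E] (M : FinMatroid E)
    (hrep : M.Representable) (k : ℕ) (hk : 2 * k ≤ M.rk) :
    M.whitneySecond k ≤ M.whitneySecond (M.rk - k) := by
  obtain ⟨K, _, V, _, _, φ, hφ⟩ := hrep
  obtain ⟨m, ψ, hψ⟩ := to_coords (K := K) φ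
  obtain ⟨F, _, _, ψ', hψ'⟩ := reduce_field ψ
  obtain ⟨χ, hs, hχ⟩ := to_span (K := F) ψ'
  refine final_ineq (K := F) M χ (fun I => ?_) hs k hk
  rw [← hχ, ← hψ', ← hψ, LinearIndepOn_iff_linearIndepOn_image_injOn, and_comm]
  exact hφ I

end TopHeavy

open FinMatroid in
/-- **Huh–Wang: the Dowling–Wilson top-heavy conjecture in the representable case.** For a
loopless matroid `M` of rank `r` representable over some field, `W_k(M) ≤ W_{r-k}(M)` for
every `k ≤ r/2`. -/
theorem huh_wang_top_heavy {E : Type*} [Fintype E] [DecidableEq E]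
    (M : FinMatroid E) (hM : M.Loopless) (r : ℕ) (hr : M.rk = r)
    (hrep : M.Representable) :
    ∀ k : ℕ, 2 * k ≤ r → M.whitneySecond k ≤ M.whitneySecond (r - k) := by
  intro k hk
  subst hr
  exact TopHeavy.main_thm M hrep k hk
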